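/- arXiv:1806.08622 — 5 statements merged into one kernel-verified Lean document; each statement's English description precedes it below -/
import Mathlib

section
/- Let I be a combinatorial abelian ideal in Φ⁺, let a, b ∈ I be orthogonal roots, and let γ ∈ Φ be a root such that a + γ ∈ I. Then b + γ ∉ I. -/
open scoped RealInnerProductSpace

variable {V : Type*} [NormedAddCommGroup V] [InnerProductSpace ℝ V] [FiniteDimensional ℝ V]

/-- The Cartan integer `⟨a, b∨⟩ = 2⟪a,b⟫/⟪b,b⟫`, i.e. the pairing of `a` with the coroot
of `b`, in a Euclidean realization of the root system. -/
noncomputable def cartan (a b : V) : ℝ := 2 * ⟪a, b⟫ / ⟪b, b⟫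

/-- A finite reduced crystallographic root system `Φ` in a Euclidean space `V`,
together with a base `Δ` (the set `simples`); the corresponding positive system `Φ⁺`
consists of the roots that are nonnegative integer combinations of simple roots. -/
structure RootSystemWithBase (V : Type*) [NormedAddCommGroup V] [InnerProductSpace ℝ V] :
    Type _ where
  roots : Set V
  finite : roots.Finite
  ne_zero : ∀ a ∈ roots, a ≠ (0 : V)
  neg_mem : ∀ a ∈ roots, -a ∈ roots
  reduced : ∀ a ∈ roots, ∀ t : ℝ, t • a ∈ roots → t = 1 ∨ t = -1
  crystal : ∀ a ∈ roots, ∀ b ∈ roots, ∃ n : ℤ, cartan a b = (n : ℝ)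
  reflect_mem : ∀ a ∈ roots, ∀ b ∈ roots, a - cartan a b • b ∈ roots
  simples : Set V
  simples_sub : simples ⊆ roots
  indep : LinearIndependent ℝ (fun a : simples => (a : V))
  decomp : ∀ a ∈ roots,
    (∃ c : V →₀ ℕ, ↑c.support ⊆ simples ∧ a = c.sum fun b n => (n : ℝ) • b) ∨
    (∃ c : V →₀ ℕ, ↑c.support ⊆ simples ∧ -a = c.sum fun b n => (n : ℝ) • b)

namespace RootSystemWithBase

/-- `v` is a nonnegative integer combination of simple roots. -/
def IsNN (R : RootSystemWithBase V) (v : V) : Prop :=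
  ∃ c : V →₀ ℕ, ↑c.support ⊆ R.simples ∧ v = c.sum fun b n => (n : ℝ) • b

/-- The set `Φ⁺` of positive roots. -/
def pos (R : RootSystemWithBase V) : Set V :=
  {a ∈ R.roots | R.IsNN a}

/-- A combinatorial abelian ideal in `Φ⁺`: a subset `I ⊆ Φ⁺` such that (i) if `a ∈ I`,
`b ∈ Φ⁺` and `b - a` is a nonnegative integer combination of simple roots then `b ∈ I`,
and (ii) `a + b ∉ Φ` for all `a, b ∈ I`. -/
def IsAbelianIdeal (R : RootSystemWithBase V) (I : Set V) : Prop :=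
  I ⊆ R.pos ∧
  (∀ a ∈ I, ∀ b ∈ R.pos, R.IsNN (b - a) → b ∈ I) ∧
  (∀ a ∈ I, ∀ b ∈ I, a + b ∉ R.roots)

end RootSystemWithBase

namespace RootSystemWithBase

variable {W : Type*} [NormedAddCommGroup W] [InnerProductSpace ℝ W]

lemma sub_mem_roots (R : RootSystemWithBase W) {x y : W} (hx : x ∈ R.roots) (hy : y ∈ R.roots)
    (hne : x ≠ y) (h : 0 < ⟪x, y⟫) : x - y ∈ R.roots := by
  have hxx : 0 < ⟪x, x⟫ := real_inner_self_pos.2 (R.ne_zero x hx)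
  have hyy : 0 < ⟪y, y⟫ := real_inner_self_pos.2 (R.ne_zero y hy)
  obtain ⟨n, hn⟩ := R.crystal x hx y hy
  obtain ⟨m, hm⟩ := R.crystal y hy x hx
  have hxy := R.reflect_mem x hx y hy
  have hyx := R.reflect_mem y hy x hx
  rw [hn] at hxy
  rw [hm] at hyx
  rw [cartan, div_eq_iff hyy.ne'] at hn
  rw [cartan, div_eq_iff hxx.ne', real_inner_comm] at hm
  have hn0 : 0 < n := by
    have : (0 : ℝ) < n := pos_of_mul_pos_left (by linarith) hyy.le
    exact_mod_cast this
  have hm0 : 0 < m := by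
    have : (0 : ℝ) < m := pos_of_mul_pos_left (by linarith) hxx.le
    exact_mod_cast this
  by_cases hn1 : n = 1
  · simpa [hn1] using hxy
  by_cases hm1 : m = 1
  · have := R.neg_mem _ hyx
    simpa [hm1] using this
  have hn2 : (2 : ℝ) ≤ n := by exact_mod_cast (by lia : 2 ≤ n)
  have hm2 : (2 : ℝ) ≤ m := by exact_mod_cast (by lia : 2 ≤ m)
  have hle : ⟪x - y, x - y⟫ ≤ 0 := by
    rw [real_inner_sub_sub_self]
    nlinarith
  exact absurd (sub_eq_zero.1 (real_inner_self_nonpos.1 hle)) hne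

lemma add_mem_roots (R : RootSystemWithBase W) {x y : W} (hx : x ∈ R.roots) (hy : y ∈ R.roots)
    (hne : x ≠ -y) (h : ⟪x, y⟫ < 0) : x + y ∈ R.roots := by
  simpa using R.sub_mem_roots hx (R.neg_mem y hy) hne (by simpa using h)

/-- A string of roots in direction `y` that extends upwards from `x`, where `⟪x, y⟫ ≥ 0`,
also extends downwards. -/
lemma sub_mem_roots_of_add_mem (R : RootSystemWithBase W) {x y : W} (hx : x ∈ R.roots)
    (hy : y ∈ R.roots) (hxy : x + y ∈ R.roots) (h : 0 ≤ ⟪x, y⟫) : x - y ∈ R.roots := by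
  rcases h.eq_or_lt with h0 | hpos
  · have hc : cartan (x + y) y = 2 := by
      have hyy : ⟪y, y⟫ ≠ 0 := (real_inner_self_pos.2 (R.ne_zero y hy)).ne'
      rw [cartan, inner_add_left, ← h0, zero_add, mul_div_assoc, div_self hyy, mul_one]
    have := R.reflect_mem _ hxy y hy
    rwa [hc, two_smul, add_sub_add_right_eq_sub] at this
  · refine R.sub_mem_roots hx hy ?_ hpos
    rintro rfl
    rw [← two_smul ℝ x] at hxy
    rcases R.reduced x hx 2 hxy with h2 | h2 <;> norm_num at h2

lemma neg_notMem_pos (R : RootSystemWithBase W) {x : W} (hx : x ∈ R.pos) : -x ∉ R.pos := by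
  rintro ⟨-, d, hd, hxd⟩
  obtain ⟨hx, c, hc, hxc⟩ := hx
  let f : ℕ →+ ℝ := Nat.castAddMonoidHom ℝ
  let e : W →₀ ℝ := (c + d).mapRange f (map_zero f)
  have he : e = 0 := by
    refine linearIndepOn_iff.1 (show LinearIndepOn ℝ id R.simples from R.indep) e ?_ ?_
    · rw [Finsupp.mem_supported]
      intro v hv
      have hv' : v ∈ (c + d).support := Finsupp.support_mapRange hv
      classical
      rcases Finset.mem_union.1 (Finsupp.support_add hv') with h | h
      exacts [hc h, hd h]
    · rw [Finsupp.linearCombination_apply, Finsupp.sum_mapRange_index (by simp),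
        Finsupp.sum_add_index' (by simp) (by simp [add_smul])]
      exact (congrArg₂ (· + ·) hxc hxd).symm.trans (add_neg_cancel x)
  have hc0 : c = 0 := by
    ext v
    have hv : ((c v + d v : ℕ) : ℝ) = 0 := DFunLike.congr_fun he v
    have : c v + d v = 0 := by exact_mod_cast hv
    simpa using (Nat.add_eq_zero_iff.1 this).1
  exact R.ne_zero x hx (by simpa [hc0] using hxc)

lemma IsAbelianIdeal.inner_nonneg {R : RootSystemWithBase W} {I : Set W} (hI : R.IsAbelianIdeal I)
    {x y : W} (hx : x ∈ I) (hy : y ∈ I) : 0 ≤ ⟪x, y⟫ := by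
  by_contra! h
  refine hI.2.2 x hx y hy (R.add_mem_roots (hI.1 hx).1 (hI.1 hy).1 ?_ h)
  rintro rfl
  exact R.neg_notMem_pos (hI.1 hy) (hI.1 hx)

/-- The conclusion of the main theorem when `⟪b, γ⟫ ≤ ⟪a, γ⟫`. -/
lemma IsAbelianIdeal.add_notMem_of_inner_le {R : RootSystemWithBase W} {I : Set W}
    (hI : R.IsAbelianIdeal I) {a b γ : W} (ha : a ∈ I) (hb : b ∈ I) (hab : ⟪a, b⟫ = 0)
    (hγ : γ ∈ R.roots) (haγ : a + γ ∈ I) (hle : ⟪b, γ⟫ ≤ ⟪a, γ⟫) : b + γ ∉ I := by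
  intro hbγ
  have hbr := (hI.1 hb).1
  have hba : ⟪b, a⟫ = 0 := by rw [real_inner_comm, hab]
  have hb0 : 0 ≤ ⟪b, γ⟫ := by
    simpa [inner_add_right, hba] using hI.inner_nonneg hb haγ
  have hsub : b - γ ∈ R.roots := R.sub_mem_roots_of_add_mem hbr hγ (hI.1 hbγ).1 hb0
  have hγγ : 0 < ⟪γ, γ⟫ := real_inner_self_pos.2 (R.ne_zero γ hγ)
  have hneg : ⟪a + γ, b - γ⟫ < 0 := by
    rw [inner_add_left, inner_sub_right, inner_sub_right, hab, real_inner_comm b γ]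
    linarith
  have hne : a + γ ≠ -(b - γ) := by
    intro h
    have hab' : a = -b := by
      rw [neg_sub, sub_eq_add_neg, add_comm] at h
      exact add_left_cancel h
    subst hab'
    exact R.neg_notMem_pos (hI.1 hb) (hI.1 ha)
  have := R.add_mem_roots (hI.1 haγ).1 hsub hne hneg
  exact hI.2.2 a ha b hb (by simpa using this)

end RootSystemWithBase

/-- If `a, b` are orthogonal roots in a combinatorial abelian ideal `I` and `γ ∈ Φ` is
such that `a + γ ∈ I`, then `b + γ ∉ I`. -/
theorem stmt_1 (R : RootSystemWithBase V) (I : Set V) (hI : R.IsAbelianIdeal I)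
    (a b γ : V) (ha : a ∈ I) (hb : b ∈ I) (horth : cartan a b = 0)
    (hγ : γ ∈ R.roots) (haγ : a + γ ∈ I) :
    b + γ ∉ I := by
  intro hbγ
  have hab : ⟪a, b⟫ = 0 := by
    simpa [cartan, R.ne_zero b (hI.1 hb).1] using horth
  rcases le_total ⟪b, γ⟫ ⟪a, γ⟫ with h | h
  · exact hI.add_notMem_of_inner_le ha hb hab hγ haγ h hbγ
  · exact hI.add_notMem_of_inner_le hb ha (by rw [real_inner_comm, hab]) hγ hbγ h haγ
end

section
/- Let I be a combinatorial abelian ideal in Φ⁺, let S ⊆ I be a set of pairwise orthogonal roots, and set σ_S = ∏_{b∈S} s_b (the product of the corresponding reflections, which commute). Let a ∈ Φ be a root such that σ_S(a) = −a and such that Σ_{b∈S} ⟨a, b∨⟩ is even. Then there exist b, b′ ∈ S (not necessarily distinct) and signs ε, ε′ ∈ {+1, −1} with a = (ε b + ε′ b′)/2. More precisely: if Σ_{b∈S} ⟨a, b∨⟩ = 0 then a = (b − b′)/2 for some b, b′ ∈ S, and if Σ_{b∈S} ⟨a, b∨⟩ = 2 then a = (b + b′)/2 for some b, b′ ∈ S.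 -/
open scoped RealInnerProductSpace

variable {V : Type*} [NormedAddCommGroup V] [InnerProductSpace ℝ V] [FiniteDimensional ℝ V]

/-- The reflection `s_b` associated to a root `b`: `x ↦ x - ⟨x, b∨⟩ b`. -/
noncomputable def reflV (b : V) : V → V := fun x => x - cartan x b • b

/-- The product `σ_S = ∏_{b ∈ S} s_b` of the reflections associated to the elements of a
finite set `S` of roots (for pairwise orthogonal `S` these reflections commute, so the
product does not depend on the chosen enumeration of `S`). -/
noncomputable def sigmaS (S : Finset V) : V → V :=
  S.toList.foldr (fun b f => reflV b ∘ f) id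

section

omit [FiniteDimensional ℝ V]

theorem cartan_sub_left (x y b : V) : cartan (x - y) b = cartan x b - cartan y b := by
  simp only [cartan, inner_sub_left]
  ring

theorem cartan_add_left (x y b : V) : cartan (x + y) b = cartan x b + cartan y b := by
  simp only [cartan, inner_add_left]
  ring

theorem cartan_smul_left (t : ℝ) (x b : V) : cartan (t • x) b = t * cartan x b := by
  simp only [cartan, real_inner_smul_left]
  ring

theorem cartan_sum_left {ι : Type*} (T : Finset ι) (f : ι → V) (b : V) :
    cartan (∑ i ∈ T, f i) b = ∑ i ∈ T, cartan (f i) b := by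
  simp only [cartan, sum_inner, Finset.mul_sum, Finset.sum_div]

theorem cartan_self {b : V} (hb : b ≠ 0) : cartan b b = 2 := by
  have h : ⟪b, b⟫ ≠ 0 := inner_self_ne_zero.2 hb
  rw [cartan]
  field_simp

/-- Subtracting from `a` its components along a pairwise orthogonal list of vectors amounts to
composing the corresponding reflections. -/
theorem foldr_reflV_apply (a : V) (l : List V) (hl : l.Pairwise fun b c => cartan c b = 0) :
    l.foldr (fun b f => reflV b ∘ f) id a = a - (l.map fun b => cartan a b • b).sum := by
  induction l with
  | nil => simp
  | cons b l ih =>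
    rw [List.pairwise_cons] at hl
    have h : cartan (l.map fun c => cartan a c • c).sum b = 0 := by
      have key : ∀ l' : List V, (∀ c ∈ l', cartan c b = 0) →
          cartan (l'.map fun c => cartan a c • c).sum b = 0 := by
        intro l' hl'
        induction l' with
        | nil => simp [cartan]
        | cons c l' ih' =>
          rw [List.map_cons, List.sum_cons, cartan_add_left, cartan_smul_left,
            hl' c (by simp), ih' fun d hd => hl' d (by simp [hd])]
          simp
      exact key l hl.1
    rw [List.foldr_cons, Function.comp_apply, ih hl.2, reflV, cartan_sub_left, h,
      List.map_cons, List.sum_cons, sub_zero]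
    abel

theorem sigmaS_apply (S : Finset V) (horth : ∀ a ∈ S, ∀ b ∈ S, a ≠ b → cartan a b = 0) (a : V) :
    sigmaS S a = a - ∑ b ∈ S, cartan a b • b := by
  rw [sigmaS, foldr_reflV_apply, Finset.sum_map_toList]
  refine S.nodup_toList.imp_of_mem fun {b c} hb hc hne => ?_
  exact horth c (Finset.mem_toList.1 hc) b (Finset.mem_toList.1 hb) hne.symm

namespace RootSystemWithBase

theorem sigmaS_mem (R : RootSystemWithBase V) (S : Finset V) (hS : ↑S ⊆ R.roots) {a : V}
    (ha : a ∈ R.roots) : sigmaS S a ∈ R.roots := by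
  have key : ∀ l : List V, (∀ b ∈ l, b ∈ R.roots) →
      l.foldr (fun b f => reflV b ∘ f) id a ∈ R.roots := by
    intro l hl
    induction l with
    | nil => simpa using ha
    | cons b l ih =>
      exact R.reflect_mem _ (ih fun c hc => hl c (by simp [hc])) b (hl b (by simp))
  exact key _ fun b hb => hS (Finset.mem_toList.1 hb)

theorem sub_mem_of_cartan_eq_one (R : RootSystemWithBase V) {a b : V} (ha : a ∈ R.roots)
    (hb : b ∈ R.roots) (h : cartan a b = 1) : a - b ∈ R.roots := by
  simpa [h] using R.reflect_mem a ha b hb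

theorem IsNN.add {R : RootSystemWithBase V} {x y : V} (hx : R.IsNN x) (hy : R.IsNN y) :
    R.IsNN (x + y) := by
  classical
  obtain ⟨c, hc, rfl⟩ := hx
  obtain ⟨d, hd, rfl⟩ := hy
  refine ⟨c + d, ?_, ?_⟩
  · intro z hz
    rcases Finset.mem_union.1 (Finsupp.support_add hz) with h | h
    exacts [hc h, hd h]
  · rw [Finsupp.sum_add_index'] <;> simp [add_smul]

namespace IsAbelianIdeal

variable {R : RootSystemWithBase V} {I : Set V}

theorem mem_roots (hI : R.IsAbelianIdeal I) {b : V} (hb : b ∈ I) : b ∈ R.roots :=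
  (hI.1 hb).1

theorem add_mem (hI : R.IsAbelianIdeal I) {b p : V} (hb : b ∈ I) (hp : R.IsNN p)
    (h : b + p ∈ R.roots) : b + p ∈ I :=
  hI.2.1 b hb _ ⟨h, (hI.1 hb).2.add hp⟩ (by simpa using hp)

theorem add_mem_or_sub_mem (hI : R.IsAbelianIdeal I) {b b' p : V} (hb : b ∈ I) (hb' : b' ∈ I)
    (hp : p ∈ R.roots) (h : b + p ∈ R.roots) (h' : b' - p ∈ R.roots) :
    b + p ∈ I ∨ b' - p ∈ I := by
  rcases R.decomp p hp with hp | hp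
  · exact .inl (hI.add_mem hb hp h)
  · rw [sub_eq_add_neg] at h' ⊢
    exact .inr (hI.add_mem hb' hp h')

/-- The midpoint of two orthogonal roots of an abelian ideal lies in the ideal as soon as it is
a root. -/
theorem midpoint_mem (hI : R.IsAbelianIdeal I) {x y : V} (hx : x ∈ I) (hy : y ∈ I)
    (hxy : cartan x y = 0) (h : (2⁻¹ : ℝ) • (x + y) ∈ R.roots) : (2⁻¹ : ℝ) • (x + y) ∈ I := by
  have hy0 := R.ne_zero y (hI.mem_roots hy)
  have hp : (2⁻¹ : ℝ) • (x + y) - y ∈ R.roots := by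
    refine R.sub_mem_of_cartan_eq_one h (hI.mem_roots hy) ?_
    rw [cartan_smul_left, cartan_add_left, hxy, cartan_self hy0]
    norm_num
  have e : x - ((2⁻¹ : ℝ) • (x + y) - y) = (2⁻¹ : ℝ) • (x + y) := by module
  have := hI.add_mem_or_sub_mem hy hx hp (by simpa using h) (by rwa [e])
  rwa [e, add_sub_cancel, or_self] at this

theorem add_midpoint_notMem (hI : R.IsAbelianIdeal I) {b x y : V} (hb : b ∈ I) (hx : x ∈ I)
    (hy : y ∈ I) (hxy : cartan x y = 0) (h : cartan b (b + (2⁻¹ : ℝ) • (x + y)) = 1) :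
    b + (2⁻¹ : ℝ) • (x + y) ∉ R.roots := by
  intro ha
  have hq := R.neg_mem _ (R.sub_mem_of_cartan_eq_one (hI.mem_roots hb) ha h)
  rw [neg_sub, add_sub_cancel_left] at hq
  exact hI.2.2 b hb _ (hI.midpoint_mem hx hy hxy hq) ha

theorem half_sum_four_notMem (hI : R.IsAbelianIdeal I) {x y z w : V} (hx : x ∈ I) (hy : y ∈ I)
    (hz : z ∈ I) (hw : w ∈ I) (hyx : cartan y x = 0) (hzx : cartan z x = 0)
    (hwx : cartan w x = 0) (hxz : cartan x z = 0) (hyz : cartan y z = 0) (hwz : cartan w z = 0)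
    (hxw : cartan x w = 0) (hyw : cartan y w = 0) (hzw : cartan z w = 0) :
    (2⁻¹ : ℝ) • (x + y + z + w) ∉ R.roots := by
  intro ha
  have hx2 := cartan_self (R.ne_zero x (hI.mem_roots hx))
  have hz2 := cartan_self (R.ne_zero z (hI.mem_roots hz))
  have hw2 := cartan_self (R.ne_zero w (hI.mem_roots hw))
  have h1 : (2⁻¹ : ℝ) • (x + y + z + w) - x ∈ R.roots := by
    refine R.sub_mem_of_cartan_eq_one ha (hI.mem_roots hx) ?_
    simp only [cartan_smul_left, cartan_add_left, *]
    norm_num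
  have h2 : (2⁻¹ : ℝ) • (x + y + z + w) - z ∈ R.roots := by
    refine R.sub_mem_of_cartan_eq_one ha (hI.mem_roots hz) ?_
    simp only [cartan_smul_left, cartan_add_left, *]
    norm_num
  have h3 : (2⁻¹ : ℝ) • (x + y + z + w) - z - w ∈ R.roots := by
    refine R.sub_mem_of_cartan_eq_one h2 (hI.mem_roots hw) ?_
    simp only [cartan_smul_left, cartan_add_left, cartan_sub_left, *]
    norm_num
  have e1 : w + ((2⁻¹ : ℝ) • (x + y + z + w) - z - w) = (2⁻¹ : ℝ) • (x + y + z + w) - z := by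
    abel
  have e2 : y - ((2⁻¹ : ℝ) • (x + y + z + w) - z - w) = (2⁻¹ : ℝ) • (x + y + z + w) - x := by
    module
  rcases hI.add_mem_or_sub_mem hw hy h3 (by rwa [e1]) (by rwa [e2]) with h | h
  · rw [e1] at h
    exact hI.2.2 _ h z hz (by simpa using ha)
  · rw [e2] at h
    exact hI.2.2 _ h x hx (by simpa using ha)

open Classical in
/-- A root that is half of a positive integer combination, with even coefficient sum, of pairwise
orthogonal roots in an abelian ideal is an element of the ideal or the midpoint of two. -/
theorem half_sum_cases (hI : R.IsAbelianIdeal I) (T : Finset V) (hT : ↑T ⊆ I)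
    (horth : ∀ a ∈ T, ∀ b ∈ T, a ≠ b → cartan a b = 0) (k : V → ℤ) (hk : ∀ b ∈ T, 0 < k b)
    (heven : Even (∑ b ∈ T, k b)) (ha : (2⁻¹ : ℝ) • ∑ b ∈ T, (k b : ℝ) • b ∈ R.roots) :
    (∃ b, T = {b} ∧ k b = 2) ∨ ∃ b b', b ≠ b' ∧ T = {b, b'} ∧ k b = 1 ∧ k b' = 1 := by
  set a := (2⁻¹ : ℝ) • ∑ b ∈ T, (k b : ℝ) • b with ha_def
  have ha0 : 0 < ⟪a, a⟫ := real_inner_self_pos.2 (R.ne_zero a ha)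
  have hroot : ∀ b ∈ T, b ∈ R.roots := fun b hb => hI.mem_roots (hT hb)
  have hpair : ∀ b ∈ T, cartan a b = k b := by
    intro b hb
    rw [ha_def, cartan_smul_left, cartan_sum_left, Finset.sum_eq_single b]
    · rw [cartan_smul_left, cartan_self (R.ne_zero b (hroot b hb))]
      ring
    · intro c hc hcb
      rw [cartan_smul_left, horth c hc b hb hcb, mul_zero]
    · exact fun h => absurd hb h
  have hm : ∀ b : V, ∃ m : ℤ, b ∈ T → cartan b a = m := by
    intro b
    by_cases hb : b ∈ T
    · obtain ⟨m, h⟩ := R.crystal b (hroot b hb) a ha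
      exact ⟨m, fun _ => h⟩
    · exact ⟨0, fun h => absurd h hb⟩
  choose m hm using hm
  have hmpos : ∀ b ∈ T, 0 < m b := by
    intro b hb
    have hb0 : 0 < ⟪b, b⟫ := real_inner_self_pos.2 (R.ne_zero b (hroot b hb))
    have h := hpair b hb
    have hkb : (0 : ℝ) < k b := by exact_mod_cast hk b hb
    rw [← h, cartan, div_pos_iff_of_pos_right hb0] at hkb
    have : (0 : ℝ) < m b := by
      rw [← hm b hb, cartan, real_inner_comm]
      positivity
    exact_mod_cast this
  have hsum : ∑ b ∈ T, k b * m b = 4 := by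
    have h := cartan_self (R.ne_zero a ha)
    nth_rewrite 1 [ha_def] at h
    rw [cartan_smul_left, cartan_sum_left] at h
    have h' : ∑ b ∈ T, cartan ((k b : ℝ) • b) a = ∑ b ∈ T, ((k b * m b : ℤ) : ℝ) := by
      refine Finset.sum_congr rfl fun b hb => ?_
      rw [cartan_smul_left, hm b hb]
      push_cast
      ring
    rw [h'] at h
    have : ((∑ b ∈ T, k b * m b : ℤ) : ℝ) = 4 := by
      push_cast at h ⊢
      linarith
    exact_mod_cast this
  have hcard : T.card ≤ 4 := by
    have h : ∑ b ∈ T, (1 : ℤ) ≤ ∑ b ∈ T, k b * m b :=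
      Finset.sum_le_sum fun b hb => Int.add_one_le_of_lt (mul_pos (hk b hb) (hmpos b hb))
    rw [hsum] at h
    simpa using h
  have hle : ∀ b ∈ T, k b ≤ k b * m b ∧ m b ≤ k b * m b := fun b hb =>
    ⟨le_mul_of_one_le_right (hk b hb).le (hmpos b hb),
      le_mul_of_one_le_left (hmpos b hb).le (hk b hb)⟩
  have hcard0 : T.card ≠ 0 := by
    intro h
    simp [Finset.card_eq_zero.1 h] at hsum
  have hcases : T.card = 1 ∨ T.card = 2 ∨ T.card = 3 ∨ T.card = 3 + 1 := by omega
  rcases hcases with h | h | h | h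
  · obtain ⟨x, hTx⟩ := Finset.card_eq_one.1 h
    have hx : x ∈ T := by simp [hTx]
    have hkx := hk x hx
    have hmx := hmpos x hx
    have hlx := hle x hx
    rw [hTx, Finset.sum_singleton] at hsum heven ha_def
    refine .inl ⟨x, hTx, ?_⟩
    have hk4 : k x ≤ 4 := by omega
    have hm4 : m x ≤ 4 := by omega
    generalize k x = p at *
    generalize m x = q at *
    have hp : p = 2 ∨ p = 4 := by
      obtain ⟨r, rfl⟩ := heven
      interval_cases q <;> omega
    refine hp.resolve_right fun hp => ?_
    have := R.reduced x (hroot x hx) 2 (by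
      rw [ha_def, hp] at ha
      convert ha using 1
      push_cast
      module)
    norm_num at this
  · obtain ⟨x, y, hxy, hTxy⟩ := Finset.card_eq_two.1 h
    have hx : x ∈ T := by simp [hTxy]
    have hy : y ∈ T := by simp [hTxy]
    have hkx := hk x hx
    have hky := hk y hy
    have hmx := hmpos x hx
    have hmy := hmpos y hy
    have hlx := hle x hx
    have hly := hle y hy
    have hcx := hm x hx
    have hcy := hm y hy
    rw [hTxy, Finset.sum_pair hxy] at hsum heven ha_def
    refine .inr ⟨x, y, hxy, hTxy, ?_⟩
    have hnum : (k x = 1 ∧ k y = 1) ∨ (k x = 2 ∧ k y = 2) ∨ (k x = 3 ∧ k y = 1 ∧ m x = 1) ∨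
        (k x = 1 ∧ k y = 3 ∧ m y = 1) := by
      clear hcx hcy ha_def
      generalize k x = p at *
      generalize k y = p' at *
      generalize m x = q at *
      generalize m y = q' at *
      have : p ≤ 3 := by omega
      have : p' ≤ 3 := by omega
      obtain ⟨r, hr⟩ := heven
      interval_cases p <;> interval_cases p' <;> omega
    rcases hnum with h | ⟨h, h'⟩ | ⟨h, h', h''⟩ | ⟨h, h', h''⟩
    · exact h
    · refine absurd ha ?_
      have e : a = x + y := by
        rw [ha_def, h, h']
        push_cast
        module
      rw [e]
      exact hI.2.2 x (hT hx) y (hT hy)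
    · refine absurd ha ?_
      have e : a = x + (2⁻¹ : ℝ) • (x + y) := by
        rw [ha_def, h, h']
        push_cast
        module
      rw [e] at hcx ⊢
      exact hI.add_midpoint_notMem (hT hx) (hT hx) (hT hy) (horth x hx y hy hxy)
        (by rw [hcx, h'', Int.cast_one])
    · refine absurd ha ?_
      have e : a = y + (2⁻¹ : ℝ) • (x + y) := by
        rw [ha_def, h, h']
        push_cast
        module
      rw [e] at hcy ⊢
      exact hI.add_midpoint_notMem (hT hy) (hT hx) (hT hy) (horth x hx y hy hxy)
        (by rw [hcy, h'', Int.cast_one])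
  · obtain ⟨x, y, z, hxy, hxz, hyz, hTxyz⟩ := Finset.card_eq_three.1 h
    have hx : x ∈ T := by simp [hTxyz]
    have hy : y ∈ T := by simp [hTxyz]
    have hz : z ∈ T := by simp [hTxyz]
    have hkx := hk x hx
    have hky := hk y hy
    have hkz := hk z hz
    have hmx := hmpos x hx
    have hmy := hmpos y hy
    have hmz := hmpos z hz
    have hlx := hle x hx
    have hly := hle y hy
    have hlz := hle z hz
    have hcx := hm x hx
    have hcy := hm y hy
    have hcz := hm z hz
    rw [hTxyz, Finset.sum_insert (by simp [hxy, hxz]), Finset.sum_pair hyz]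
      at hsum heven ha_def
    have hnum : (k x = 2 ∧ k y = 1 ∧ k z = 1 ∧ m x = 1) ∨
        (k x = 1 ∧ k y = 2 ∧ k z = 1 ∧ m y = 1) ∨ (k x = 1 ∧ k y = 1 ∧ k z = 2 ∧ m z = 1) := by
      clear hcx hcy hcz ha_def
      generalize k x = p at *
      generalize k y = p' at *
      generalize k z = p'' at *
      generalize m x = q at *
      generalize m y = q' at *
      generalize m z = q'' at *
      have : p ≤ 2 := by omega
      have : p' ≤ 2 := by omega
      have : p'' ≤ 2 := by omega
      obtain ⟨r, hr⟩ := heven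
      interval_cases p <;> interval_cases p' <;> interval_cases p'' <;> omega
    refine absurd ha ?_
    rcases hnum with ⟨h1, h2, h3, h4⟩ | ⟨h1, h2, h3, h4⟩ | ⟨h1, h2, h3, h4⟩
    · have e : a = x + (2⁻¹ : ℝ) • (y + z) := by
        rw [ha_def, h1, h2, h3]
        push_cast
        module
      rw [e] at hcx ⊢
      exact hI.add_midpoint_notMem (hT hx) (hT hy) (hT hz) (horth y hy z hz hyz)
        (by rw [hcx, h4, Int.cast_one])
    · have e : a = y + (2⁻¹ : ℝ) • (x + z) := by
        rw [ha_def, h1, h2, h3]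
        push_cast
        module
      rw [e] at hcy ⊢
      exact hI.add_midpoint_notMem (hT hy) (hT hx) (hT hz) (horth x hx z hz hxz)
        (by rw [hcy, h4, Int.cast_one])
    · have e : a = z + (2⁻¹ : ℝ) • (x + y) := by
        rw [ha_def, h1, h2, h3]
        push_cast
        module
      rw [e] at hcz ⊢
      exact hI.add_midpoint_notMem (hT hz) (hT hx) (hT hy) (horth x hx y hy hxy)
        (by rw [hcz, h4, Int.cast_one])
  · obtain ⟨x, T', hxT', hTx, hT'⟩ := Finset.card_eq_succ.1 h
    obtain ⟨y, z, w, hyz, hyw, hzw, rfl⟩ := Finset.card_eq_three.1 hT'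
    simp only [Finset.mem_insert, Finset.mem_singleton, not_or] at hxT'
    obtain ⟨hxy, hxz, hxw⟩ := hxT'
    have hx : x ∈ T := by simp [← hTx]
    have hy : y ∈ T := by simp [← hTx]
    have hz : z ∈ T := by simp [← hTx]
    have hw : w ∈ T := by simp [← hTx]
    have hkx := hk x hx
    have hky := hk y hy
    have hkz := hk z hz
    have hkw := hk w hw
    have hlx := hle x hx
    have hly := hle y hy
    have hlz := hle z hz
    have hlw := hle w hw
    rw [← hTx, Finset.sum_insert (by simp [hxy, hxz, hxw]),
      Finset.sum_insert (by simp [hyz, hyw]), Finset.sum_pair hzw] at hsum ha_def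
    have h1 : k x = 1 := by omega
    have h2 : k y = 1 := by omega
    have h3 : k z = 1 := by omega
    have h4 : k w = 1 := by omega
    have e : a = (2⁻¹ : ℝ) • (x + y + z + w) := by
      rw [ha_def, h1, h2, h3, h4]
      push_cast
      module
    rw [e] at ha
    exact absurd ha <| hI.half_sum_four_notMem (hT hx) (hT hy) (hT hz) (hT hw)
      (horth y hy x hx (Ne.symm hxy)) (horth z hz x hx (Ne.symm hxz))
      (horth w hw x hx (Ne.symm hxw)) (horth x hx z hz hxz) (horth y hy z hz hyz)
      (horth w hw z hz (Ne.symm hzw)) (horth x hx w hw hxw) (horth y hy w hw hyw)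
      (horth z hz w hw hzw)

end IsAbelianIdeal

end RootSystemWithBase

end

/-- If `S` is a pairwise orthogonal subset of a combinatorial abelian ideal,
`σ_S(a) = -a` and `Σ_{b ∈ S} ⟨a, b∨⟩` is even, then `a = (εb + ε'b')/2` with
`b, b' ∈ S` and signs `ε, ε'`; more precisely if the sum is `0` then `a = (b - b')/2`,
and if the sum is `2` then `a = (b + b')/2`. -/
theorem stmt_3 (R : RootSystemWithBase V) (I : Set V) (hI : R.IsAbelianIdeal I)
    (S : Finset V) (hSI : ↑S ⊆ I)
    (horth : ∀ a ∈ S, ∀ b ∈ S, a ≠ b → cartan a b = 0)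
    (a : V) (haΦ : a ∈ R.roots) (hfix : sigmaS S a = -a)
    (heven : ∃ m : ℤ, ∑ b ∈ S, cartan a b = ((2 * m : ℤ) : ℝ)) :
    (∃ b ∈ S, ∃ b' ∈ S, ∃ ε ε' : ℝ, (ε = 1 ∨ ε = -1) ∧ (ε' = 1 ∨ ε' = -1) ∧
        a = (2⁻¹ : ℝ) • (ε • b + ε' • b')) ∧
    (∑ b ∈ S, cartan a b = 0 → ∃ b ∈ S, ∃ b' ∈ S, a = (2⁻¹ : ℝ) • (b - b')) ∧
    (∑ b ∈ S, cartan a b = 2 → ∃ b ∈ S, ∃ b' ∈ S, a = (2⁻¹ : ℝ) • (b + b')) := by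
  classical
  have hSroots : ↑S ⊆ R.roots := fun b hb => hI.mem_roots (hSI hb)
  have hn : ∀ b : V, ∃ n : ℤ, b ∈ S → cartan a b = n := by
    intro b
    by_cases hb : b ∈ S
    · obtain ⟨n, h⟩ := R.crystal a haΦ b (hSroots hb)
      exact ⟨n, fun _ => h⟩
    · exact ⟨0, fun h => absurd h hb⟩
  choose n hn using hn
  have hsumn : ∑ b ∈ S, cartan a b = ((∑ b ∈ S, n b : ℤ) : ℝ) := by
    push_cast
    exact Finset.sum_congr rfl hn
  have hexp : a = (2⁻¹ : ℝ) • ∑ b ∈ S, (n b : ℝ) • b := by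
    rw [sigmaS_apply S horth, Finset.sum_congr rfl fun b hb => by rw [hn b hb]] at hfix
    rw [sub_eq_iff_eq_add] at hfix
    have h2 : (2 : ℝ) • a = ∑ b ∈ S, (n b : ℝ) • b := by
      rw [two_smul]
      nth_rewrite 1 [hfix]
      abel
    rw [← h2, inv_smul_smul₀ two_ne_zero]
  set U := S.filter fun b => n b < 0 with hU
  set T := S.filter fun b => n b ≠ 0 with hTdef
  have hUS : U ⊆ S := Finset.filter_subset _ _
  have hTS : T ⊆ S := Finset.filter_subset _ _
  have habs : (2⁻¹ : ℝ) • ∑ b ∈ T, ((|n b| : ℤ) : ℝ) • b ∈ R.roots := by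
    have h := R.sigmaS_mem U (fun b hb => hSroots (hUS hb)) haΦ
    rw [sigmaS_apply U fun b hb c hc => horth b (hUS hb) c (hUS hc),
      Finset.sum_congr rfl fun b hb => by rw [hn b (hUS hb)]] at h
    convert h using 1
    rw [hTdef, Finset.sum_filter_of_ne fun b _ => mt fun h0 => by simp [h0]]
    rw [hU,
      Finset.sum_filter]
    nth_rewrite 1 [hexp]
    rw [Finset.smul_sum, Finset.smul_sum, ← Finset.sum_sub_distrib]
    refine Finset.sum_congr rfl fun b _ => ?_
    split_ifs with hb
    · rw [abs_of_neg hb]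
      push_cast
      module
    · rw [abs_of_nonneg (not_lt.1 hb), sub_zero]
  have hsumT : ∑ b ∈ S, n b = ∑ b ∈ T, n b := by
    rw [hTdef, Finset.sum_filter_ne_zero]
  have hexpT : a = (2⁻¹ : ℝ) • ∑ b ∈ T, (n b : ℝ) • b := by
    rw [hTdef, Finset.sum_filter_of_ne fun b _ => mt fun h0 => by simp [h0]]
    exact hexp
  have hevenT : Even (∑ b ∈ T, |n b|) := by
    obtain ⟨r, hr⟩ := heven
    rw [hsumn] at hr
    have hr' : ∑ b ∈ T, n b = 2 * r := by
      rw [← hsumT]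
      exact_mod_cast hr
    have : Even (∑ b ∈ T, |n b| - ∑ b ∈ T, n b) := by
      rw [← Finset.sum_sub_distrib]
      refine Finset.even_sum _ fun b _ => ?_
      rw [Int.even_sub, even_abs]
    rw [Int.even_sub] at this
    exact this.2 (hr' ▸ even_two_mul r)
  have hsum2 : ((∑ b ∈ T, n b : ℤ) : ℝ) = 2 ↔ ∑ b ∈ T, n b = 2 := by norm_cast
  rw [hsumn, hsumT, Int.cast_eq_zero, hsum2]
  rcases hI.half_sum_cases T (fun b hb => hSI (hTS hb))
    (fun b hb c hc => horth b (hTS hb) c (hTS hc)) (fun b => |n b|)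
    (fun b hb => abs_pos.2 (Finset.mem_filter.1 hb).2) hevenT habs with
    ⟨b, hTb, hb⟩ | ⟨b, b', hne, hTb, hb, hb'⟩
  · have hbS : b ∈ S := hTS (by simp [hTb])
    rw [hTb, Finset.sum_singleton] at hexpT ⊢
    rcases (abs_eq (by norm_num)).1 hb with h | h <;> rw [h] at hexpT ⊢ <;>
      push_cast at hexpT <;> refine ⟨?_, by norm_num, ?_⟩
    · exact ⟨b, hbS, b, hbS, 1, 1, .inl rfl, .inl rfl, by rw [hexpT]; module⟩
    · exact fun _ => ⟨b, hbS, b, hbS, by rw [hexpT]; module⟩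
    · exact ⟨b, hbS, b, hbS, -1, -1, .inr rfl, .inr rfl, by rw [hexpT]; module⟩
    · norm_num
  · have hbS : b ∈ S := hTS (by simp [hTb])
    have hbS' : b' ∈ S := hTS (by simp [hTb])
    rw [hTb, Finset.sum_pair hne] at hexpT ⊢
    refine ⟨⟨b, hbS, b', hbS', n b, n b', ?_, ?_, hexpT⟩, ?_, ?_⟩
    · exact_mod_cast (abs_eq zero_le_one).1 hb
    · exact_mod_cast (abs_eq zero_le_one).1 hb'
    · intro h0
      rcases (abs_eq zero_le_one).1 hb with h | h
      · have h' : n b' = -1 := by omega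
        refine ⟨b, hbS, b', hbS', ?_⟩
        rw [hexpT, h, h']
        push_cast
        module
      · have h' : n b' = 1 := by omega
        refine ⟨b', hbS', b, hbS, ?_⟩
        rw [hexpT, h, h']
        push_cast
        module
    · intro h2
      have h : n b = 1 := by rcases (abs_eq zero_le_one).1 hb with h | h <;>
        rcases (abs_eq zero_le_one).1 hb' with h' | h' <;> omega
      have h' : n b' = 1 := by omega
      refine ⟨b, hbS, b', hbS', ?_⟩
      rw [hexpT, h, h']
      push_cast
      module
end

section
/- Let I be a combinatorial abelian ideal in Φ⁺ and let S ⊆ I be a set of pairwise orthogonal roots. Then for every root η ∈ Φ one has Σ_{b∈S} ⟨η, b∨⟩ ≤ 3. -/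
open scoped RealInnerProductSpace

variable {V : Type*} [NormedAddCommGroup V] [InnerProductSpace ℝ V] [FiniteDimensional ℝ V]

namespace RootSystemWithBase

theorem IsNN.add_s4 {R : RootSystemWithBase V} {v w : V} (hv : R.IsNN v) (hw : R.IsNN w) :
    R.IsNN (v + w) := by
  classical
  obtain ⟨c, hc, rfl⟩ := hv
  obtain ⟨d, hd, rfl⟩ := hw
  refine ⟨c + d, fun x hx => ?_, ?_⟩
  · rcases Finset.mem_union.1 (Finsupp.support_add hx) with h | h
    · exact hc h
    · exact hd h
  · rw [Finsupp.sum_add_index']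
    · simp
    · intro a m n
      rw [Nat.cast_add, add_smul]

theorem inner_self_pos (R : RootSystemWithBase V) {a : V} (ha : a ∈ R.roots) :
    0 < ⟪a, a⟫ :=
  real_inner_self_pos.2 (R.ne_zero a ha)

theorem sub_mem_roots_s4 (R : RootSystemWithBase V) {a b : V} (ha : a ∈ R.roots)
    (hb : b ∈ R.roots) (hab : 0 < cartan a b) (hne : a ≠ b) : a - b ∈ R.roots := by
  obtain ⟨n, hn⟩ := R.crystal a ha b hb
  obtain ⟨m, hm⟩ := R.crystal b hb a ha
  have ha0 := R.inner_self_pos ha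
  have hb0 := R.inner_self_pos hb
  have h1 : 2 * ⟪a, b⟫ = n * ⟪b, b⟫ := by
    rw [← hn, cartan]; field_simp
  have h2 : 2 * ⟪a, b⟫ = m * ⟪a, a⟫ := by
    rw [← hm, cartan, real_inner_comm]; field_simp
  have hn0 : 0 < n := by
    rw [hn] at hab; exact_mod_cast hab
  have hm0 : 0 < m := by
    have : (0 : ℝ) < n * ⟪b, b⟫ := mul_pos (by exact_mod_cast hn0) hb0
    have h : (0 : ℝ) < m := pos_of_mul_pos_left (by linarith) ha0.le
    exact_mod_cast h
  by_cases hn1 : n = 1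
  · have := R.reflect_mem a ha b hb
    simpa [hn, hn1] using this
  by_cases hm1 : m = 1
  · have := R.neg_mem _ (R.reflect_mem b hb a ha)
    simpa [hm, hm1] using this
  have hn2 : (2 : ℝ) ≤ n := by exact_mod_cast (by omega : 2 ≤ n)
  have hm2 : (2 : ℝ) ≤ m := by exact_mod_cast (by omega : 2 ≤ m)
  have h : ⟪a - b, a - b⟫ = ⟪a, a⟫ - 2 * ⟪a, b⟫ + ⟪b, b⟫ := real_inner_sub_sub_self a b
  have h0 : 0 < ⟪a - b, a - b⟫ := real_inner_self_pos.2 (sub_ne_zero.2 hne)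
  nlinarith

/-- By Bessel's inequality, the pairings of a root with pairwise orthogonal roots sum to at most
`4`, and equality forces the root to be half the corresponding combination. -/
theorem extremal_of_four_le (R : RootSystemWithBase V) {S : Finset V} (hS : ↑S ⊆ R.roots)
    (horth : ∀ a ∈ S, ∀ b ∈ S, a ≠ b → cartan a b = 0) {η : V} (hη : η ∈ R.roots)
    (n : V → ℤ) (hn : ∀ b ∈ S, cartan η b = n b) (h4 : 4 ≤ ∑ b ∈ S, n b) :
    (∀ b ∈ S, 0 ≤ n b) ∧ ∑ b ∈ S, n b = 4 ∧ (2 : ℤ) • η = ∑ b ∈ S, n b • b := by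
  have hm' : ∀ b, ∃ m : ℤ, b ∈ S → cartan b η = m := fun b => by
    by_cases hb : b ∈ S
    · obtain ⟨m, hm⟩ := R.crystal b (hS hb) η hη
      exact ⟨m, fun _ => hm⟩
    · exact ⟨0, fun h => absurd h hb⟩
  choose m hm using hm'
  have hη0 := R.inner_self_pos hη
  have key : ∀ b ∈ S, 2 * ⟪η, b⟫ = n b * ⟪b, b⟫ ∧ 2 * ⟪η, b⟫ = m b * ⟪η, η⟫ := fun b hb => by
    have hb0 := R.inner_self_pos (hS hb)
    constructor
    · rw [← hn b hb, cartan]; field_simp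
    · rw [← hm b hb, cartan, real_inner_comm]; field_simp
  have hle : ∀ b ∈ S, n b ≤ n b * m b ∧ (n b = n b * m b → 0 ≤ n b) := fun b hb => by
    have hb0 := R.inner_self_pos (hS hb)
    obtain ⟨h1, h2⟩ := key b hb
    rcases lt_trichotomy (n b) 0 with h | h | h
    · have : (m b : ℝ) < 0 := by
        have hr : (n b : ℝ) < 0 := by exact_mod_cast h
        by_contra! hc
        nlinarith [mul_neg_of_neg_of_pos hr hb0, mul_nonneg hc hη0.le]
      have hmb : m b < 0 := by exact_mod_cast this
      constructor
      · nlinarith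
      · intro; nlinarith
    · simp [h]
    · have : (0 : ℝ) < m b := by
        have hr : (0 : ℝ) < n b := by exact_mod_cast h
        by_contra! hc
        nlinarith [mul_pos hr hb0, mul_nonneg (neg_nonneg.2 hc) hη0.le]
      have hmb : 0 < m b := by exact_mod_cast this
      exact ⟨by nlinarith, fun _ => h.le⟩
  set y : V := ∑ b ∈ S, (n b : ℝ) • b with hy
  have hηy : 2 * ⟪η, y⟫ = (∑ b ∈ S, (n b * m b : ℝ)) * ⟪η, η⟫ := by
    rw [hy, inner_sum, Finset.mul_sum, Finset.sum_mul]
    refine Finset.sum_congr rfl fun b hb => ?_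
    rw [real_inner_smul_right]
    linear_combination (n b : ℝ) * (key b hb).2
  have hyy : ⟪y, y⟫ = 2 * ⟪η, y⟫ := by
    have hby : ∀ b ∈ S, ⟪b, y⟫ = n b * ⟪b, b⟫ := fun b hb => by
      rw [hy, inner_sum, Finset.sum_eq_single_of_mem b hb, real_inner_smul_right]
      intro c hc hcb
      have h := horth b hb c hc hcb.symm
      rw [cartan, div_eq_zero_iff] at h
      rw [real_inner_smul_right]
      rcases h with h | h
      · have : ⟪b, c⟫ = 0 := by linarith
        rw [this, mul_zero]
      · exact absurd h (R.inner_self_pos (hS hc)).ne'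
    calc ⟪y, y⟫ = ∑ b ∈ S, ⟪(n b : ℝ) • b, y⟫ := by rw [← sum_inner]
      _ = ∑ b ∈ S, 2 * ⟪η, (n b : ℝ) • b⟫ := by
        refine Finset.sum_congr rfl fun b hb => ?_
        rw [real_inner_smul_left, real_inner_smul_right, hby b hb]
        linear_combination -(n b : ℝ) * (key b hb).1
      _ = 2 * ⟪η, y⟫ := by rw [hy, inner_sum, Finset.mul_sum]
  have hx : ⟪(2 : ℝ) • η - y, (2 : ℝ) • η - y⟫ = (4 - ∑ b ∈ S, (n b * m b : ℝ)) * ⟪η, η⟫ := by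
    rw [real_inner_sub_sub_self, hyy]
    simp only [real_inner_smul_left, real_inner_smul_right]
    linear_combination -hηy
  have hprod : ∑ b ∈ S, n b * m b ≤ 4 := by
    have h0 : 0 ≤ ⟪(2 : ℝ) • η - y, (2 : ℝ) • η - y⟫ := real_inner_self_nonneg
    rw [hx] at h0
    have := nonneg_of_mul_nonneg_left h0 hη0
    exact_mod_cast (by linarith : ∑ b ∈ S, (n b * m b : ℝ) ≤ 4)
  have hsum := Finset.sum_le_sum fun b hb => (hle b hb).1
  have heq := (Finset.sum_eq_sum_iff_of_le fun b hb => (hle b hb).1).1 (by omega)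
  refine ⟨fun b hb => (hle b hb).2 (heq b hb), by omega, ?_⟩
  have h4' : ∑ b ∈ S, (n b * m b : ℝ) = 4 := by
    exact_mod_cast (by omega : ∑ b ∈ S, n b * m b = 4)
  rw [h4', sub_self, zero_mul, inner_self_eq_zero, sub_eq_zero, hy] at hx
  simpa only [← Int.cast_smul_eq_zsmul ℝ, Int.cast_ofNat] using hx

theorem IsAbelianIdeal.add_notMem {R : RootSystemWithBase V} {I : Set V}
    (hI : R.IsAbelianIdeal I) {a b θ : V} (ha : a ∈ I) (hb : b ∈ I) (hθ : R.IsNN θ)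
    (haθ : a + θ ∈ R.roots) : a + θ + b ∉ R.roots :=
  hI.2.2 _ (hI.2.1 a ha _ ⟨haθ, (hI.1 ha).2.add_s4 hθ⟩ (by simpa using hθ)) _ hb

end RootSystemWithBase

/-- Splitting off one copy of `r` from a nonnegative integer combination of elements of `S`. -/
theorem exists_peel {M : Type*} [AddCommGroup M] {S : Finset M} {f : M → ℤ}
    (hf : ∀ b ∈ S, 0 ≤ f b) {r : M} (hr : r ∈ S) (hfr : 0 < f r) :
    ∃ g : M → ℤ, (∀ b ∈ S, 0 ≤ g b) ∧ (∀ b, b ≠ r → g b = f b) ∧ (∀ b, g b ≤ f b) ∧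
      ∑ b ∈ S, f b = 1 + ∑ b ∈ S, g b ∧ ∑ b ∈ S, f b • b = r + ∑ b ∈ S, g b • b := by
  classical
  refine ⟨fun b => f b - if b = r then 1 else 0, fun b hb => ?_, fun b hb => by simp [hb],
    fun b => ?_, ?_, ?_⟩
  · have := hf b hb
    dsimp only
    split_ifs with h
    · subst h; omega
    · omega
  · dsimp only
    split_ifs <;> omega
  · simp [Finset.sum_sub_distrib, hr]
  · simp [Finset.sum_sub_distrib, sub_smul, ite_smul, hr]

theorem exists_pos_of_sum_pos {α : Type*} {S : Finset α} {f : α → ℤ} (h : 0 < ∑ b ∈ S, f b) :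
    ∃ r ∈ S, 0 < f r :=
  Finset.exists_lt_of_sum_lt (f := fun _ => 0) (by simpa using h)

/-- If `S` is a pairwise orthogonal subset of a combinatorial abelian ideal, then for
every root `η ∈ Φ` one has `Σ_{b ∈ S} ⟨η, b∨⟩ ≤ 3`. -/
theorem stmt_4 (R : RootSystemWithBase V) (I : Set V) (hI : R.IsAbelianIdeal I)
    (S : Finset V) (hSI : ↑S ⊆ I)
    (horth : ∀ a ∈ S, ∀ b ∈ S, a ≠ b → cartan a b = 0)
    (η : V) (hη : η ∈ R.roots) :
    ∑ b ∈ S, cartan η b ≤ 3 := by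
  have hSR : ↑S ⊆ R.roots := fun b hb => (hI.1 (hSI hb)).1
  have hn' : ∀ b, ∃ n : ℤ, b ∈ S → cartan η b = n := fun b => by
    by_cases hb : b ∈ S
    · obtain ⟨n, hn⟩ := R.crystal η hη b (hSR hb)
      exact ⟨n, fun _ => hn⟩
    · exact ⟨0, fun h => absurd h hb⟩
  choose n hn using hn'
  rw [Finset.sum_congr rfl hn]
  by_contra! hlt
  have h4 : 3 < ∑ b ∈ S, n b := by exact_mod_cast hlt
  obtain ⟨hn0, hsum, h2η⟩ := R.extremal_of_four_le hSR horth hη n hn h4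
  obtain ⟨p, hp, hnp⟩ := exists_pos_of_sum_pos (by omega : 0 < ∑ b ∈ S, n b)
  have hq : ∃ q ∈ S, q ≠ p ∧ 0 < n q := by
    by_contra! hc
    have h0 : ∀ b ∈ S, b ≠ p → n b = 0 := fun b hb hbp => le_antisymm (hc b hb hbp) (hn0 b hb)
    rw [Finset.sum_eq_single_of_mem p hp h0] at hsum
    rw [Finset.sum_eq_single_of_mem p hp fun b hb hbp => by rw [h0 b hb hbp, zero_smul],
      hsum] at h2η
    have h : η = (2 : ℝ) • p := by
      simp only [← Int.cast_smul_eq_zsmul ℝ, Int.cast_ofNat] at h2η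
      have := congrArg (fun v => (2⁻¹ : ℝ) • v) h2η
      simp only [smul_smul] at this
      norm_num at this
      exact this
    rcases R.reduced p (hSR hp) 2 (h ▸ hη) with h | h <;> norm_num at h
  obtain ⟨q, hq, hqp, hnq⟩ := hq
  have hηS : ∀ b ∈ S, η ≠ b := by
    rintro b hb rfl
    by_cases hbp : η = p
    · have := horth η hb q hq (hbp ▸ hqp.symm)
      rw [hn q hq] at this
      exact hnq.ne' (by exact_mod_cast this)
    · have := horth η hb p hp hbp
      rw [hn p hp] at this
      exact hnp.ne' (by exact_mod_cast this)
  have hsub : ∀ b ∈ S, 0 < n b → η - b ∈ R.roots := fun b hb hb0 =>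
    R.sub_mem_roots_s4 hη (hSR hb) (by rw [hn b hb]; exact_mod_cast hb0) (hηS b hb)
  have hθ : η - p - q ∈ R.roots := by
    refine R.sub_mem_roots_s4 (hsub p hp hnp) (hSR hq) ?_ fun h => ?_
    · have h : cartan (η - p) q = cartan η q - cartan p q := by
        simp only [cartan, inner_sub_left]; ring
      rw [h, horth p hp q hq hqp.symm, hn q hq, sub_zero]
      exact_mod_cast hnq
    · refine hI.2.2 p (hSI hp) q (hSI hq) ?_
      rwa [← h, add_sub_cancel]
  obtain ⟨f, hf0, hfn, hfle, hfs, hfv⟩ := exists_peel hn0 hp hnp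
  obtain ⟨g, hg0, -, hgle, hgs, hgv⟩ := exists_peel hf0 hq ((hfn q hqp).symm ▸ hnq)
  obtain ⟨r, hr, hgr⟩ := exists_pos_of_sum_pos (by omega : 0 < ∑ b ∈ S, g b)
  obtain ⟨k, hk0, -, hkle, hks, hkv⟩ := exists_peel hg0 hr hgr
  obtain ⟨s, hs, hks'⟩ := exists_pos_of_sum_pos (by omega : 0 < ∑ b ∈ S, k b)
  obtain ⟨l, hl0, -, -, hls, hlv⟩ := exists_peel hk0 hs hks'
  have hl : ∀ b ∈ S, l b = 0 := (Finset.sum_eq_zero_iff_of_nonneg hl0).1 (by omega)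
  rw [hfv, hgv, hkv, hlv, Finset.sum_eq_zero fun b hb => by rw [hl b hb, zero_smul], add_zero,
    two_smul] at h2η
  have hneg : r + -(η - p - q) = η - s := by
    rw [eq_sub_iff_add_eq, ← sub_eq_zero]
    have h : p + (q + (r + s)) - (η + η) = 0 := by rw [h2η, sub_self]
    rw [← h]
    abel
  have hpos : p + (η - p - q) = η - q := by abel
  rcases R.decomp _ hθ with h | h
  · refine hI.add_notMem (hSI hp) (hSI hq) h ?_ ?_
    · rw [hpos]; exact hsub q hq hnq
    · rwa [hpos, sub_add_cancel]
  · refine hI.add_notMem (hSI hr) (hSI hs) h ?_ ?_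
    · rw [hneg]
      exact hsub s hs (hks'.trans_le ((hkle s).trans ((hgle s).trans (hfle s))))
    · rwa [hneg, sub_add_cancel]
end

section
/- Let W be the Weyl group of Φ. For w ∈ W let N(w) be the number of positive roots a ∈ Φ⁺ with w(a) ∈ Φ⁻, and let r(w) be the dimension of the image of the linear map w − id on V. Let σ ∈ W be an involution and let α ∈ Δ be a simple root with σ(α) ∈ Φ⁻; define s∘σ = s_α σ if s_α σ = σ s_α, and s∘σ = s_α σ s_α otherwise. Then N(s∘σ) + r(s∘σ) = N(σ) + r(σ) − 2. -/
open scoped RealInnerProductSpace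

variable {V : Type*} [NormedAddCommGroup V] [InnerProductSpace ℝ V] [FiniteDimensional ℝ V]

/-- The Weyl group of the root system: the group of linear automorphisms of `V`
generated by the reflections `s_b : x ↦ x - ⟨x, b∨⟩ b` associated to the roots `b ∈ Φ`. -/
def WeylGroup (R : RootSystemWithBase V) : Subgroup (V ≃ₗ[ℝ] V) :=
  Subgroup.closure {g | ∃ b ∈ R.roots, ∀ x, g x = x - cartan x b • b}

/-- `N(w)`: the number of positive roots `a ∈ Φ⁺` with `w(a) ∈ Φ⁻` (the usual length
of `w` with respect to the base `Δ`). -/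
noncomputable def lenN (R : RootSystemWithBase V) (w : V ≃ₗ[ℝ] V) : ℕ :=
  {a : V | a ∈ R.pos ∧ -(w a) ∈ R.pos}.ncard

/-- `r(w)`: the dimension of the image of the linear map `w - id` on `V`. -/
noncomputable def rkDiff (w : V ≃ₗ[ℝ] V) : ℕ :=
  Module.finrank ℝ (LinearMap.range (w.toLinearMap - (LinearMap.id : V →ₗ[ℝ] V)))

section inversions

variable {E : Type*} [NormedAddCommGroup E] [InnerProductSpace ℝ E]

namespace RootSystemWithBase

lemma exists_linearMap_eq_on_simples (R : RootSystemWithBase E) (g : E → ℝ) :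
    ∃ f : E →ₗ[ℝ] ℝ, ∀ b ∈ R.simples, f b = g b := by
  have h : LinearIndepOn ℝ id R.simples := R.indep
  refine ⟨(Module.Basis.extend h).constr ℝ fun i => g i, fun b hb => ?_⟩
  have := (Module.Basis.extend h).constr_basis ℝ (fun i => g i)
    ⟨b, h.subset_extend (Set.subset_univ _) hb⟩
  simpa using this

lemma map_sum_eq (R : RootSystemWithBase E) {f : E →ₗ[ℝ] ℝ} {g : E → ℝ}
    (hf : ∀ b ∈ R.simples, f b = g b) {c : E →₀ ℕ} (hc : ↑c.support ⊆ R.simples) :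
    f (c.sum fun b n => (n : ℝ) • b) = ∑ b ∈ c.support, (c b : ℝ) * g b := by
  rw [Finsupp.sum, map_sum]
  refine Finset.sum_congr rfl fun b hb => ?_
  rw [map_smul, hf b (hc hb), smul_eq_mul]

lemma IsNN.map_nonneg {R : RootSystemWithBase E} {a : E} (ha : R.IsNN a) {f : E →ₗ[ℝ] ℝ}
    {g : E → ℝ} (hf : ∀ b ∈ R.simples, f b = g b) (hg : ∀ b, 0 ≤ g b) : 0 ≤ f a := by
  obtain ⟨c, hc, rfl⟩ := ha
  rw [R.map_sum_eq hf hc]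
  exact Finset.sum_nonneg fun b _ => mul_nonneg (Nat.cast_nonneg _) (hg b)

lemma mem_pos_or_neg_mem_pos (R : RootSystemWithBase E) {a : E} (ha : a ∈ R.roots) :
    a ∈ R.pos ∨ -a ∈ R.pos :=
  (R.decomp a ha).imp (fun h => ⟨ha, h⟩) fun h => ⟨R.neg_mem a ha, h⟩

lemma neg_notMem_pos_s9 (R : RootSystemWithBase E) {a : E} (ha : a ∈ R.pos) : -a ∉ R.pos := by
  intro hna
  obtain ⟨f, hf⟩ := R.exists_linearMap_eq_on_simples fun _ => 1
  have h₁ := ha.2.map_nonneg hf fun _ => zero_le_one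
  have h₂ := hna.2.map_nonneg hf fun _ => zero_le_one
  have h₀ : f a = 0 := by rw [map_neg] at h₂; linarith
  obtain ⟨ha, c, hc, rfl⟩ := ha
  rw [R.map_sum_eq hf hc, Finset.sum_eq_zero_iff_of_nonneg fun b _ => by positivity] at h₀
  refine R.ne_zero _ ha (Finset.sum_eq_zero fun b hb => ?_)
  have : (c b : ℝ) = 0 := by simpa using h₀ b hb
  simp only [this, zero_smul]

lemma simple_mem_pos (R : RootSystemWithBase E) {α : E} (hα : α ∈ R.simples) : α ∈ R.pos := by
  refine ⟨R.simples_sub hα, Finsupp.single α 1, ?_, by simp⟩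
  intro b hb
  have := Finsupp.support_single_subset hb
  rw [Finset.mem_singleton] at this
  exact this ▸ hα

/-- Adding a multiple of a simple root `α` to a positive root other than `α` yields a positive root
as soon as it yields a root. -/
lemma add_smul_simple_mem_pos (R : RootSystemWithBase E) {α : E} (hα : α ∈ R.simples) {a : E}
    (ha : a ∈ R.pos) (hne : a ≠ α) {t : ℝ} (hroot : a + t • α ∈ R.roots) :
    a + t • α ∈ R.pos := by
  classical
  refine (R.mem_pos_or_neg_mem_pos hroot).resolve_right fun hneg => ?_
  have hg (b : E) : (0 : ℝ) ≤ if b = α then 0 else 1 := by split_ifs <;> norm_num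
  obtain ⟨f, hf⟩ := R.exists_linearMap_eq_on_simples fun b => if b = α then 0 else 1
  have hfα : f α = 0 := by simp [hf α hα]
  have h₁ := ha.2.map_nonneg hf hg
  have h₂ := hneg.2.map_nonneg hf hg
  have h₀ : f a = 0 := by
    rw [map_neg, map_add, map_smul, hfα, smul_zero, add_zero] at h₂; linarith
  have hpos := ha
  obtain ⟨ha, c, hc, hac⟩ := ha
  rw [hac, R.map_sum_eq hf hc,
    Finset.sum_eq_zero_iff_of_nonneg fun b _ => mul_nonneg (Nat.cast_nonneg _) (hg b)] at h₀
  have hsum : a = (c α : ℝ) • α := by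
    rw [hac]
    refine Finset.sum_eq_single α (fun b hb hbα => ?_) fun h => ?_
    · have : (c b : ℝ) = 0 := by simpa [hbα] using h₀ b hb
      simp only [this, zero_smul]
    · simp only [Finsupp.notMem_support_iff.mp h, Nat.cast_zero, zero_smul]
  rcases R.reduced α (R.simples_sub hα) _ (hsum ▸ ha) with h | h
  · exact hne (by rw [hsum, h, one_smul])
  · exact R.neg_notMem_pos_s9 (R.simple_mem_pos hα) (by rwa [hsum, h, neg_one_smul] at hpos)

end RootSystemWithBase

lemma cartan_self_s9 {a : E} (ha : a ≠ 0) : cartan a a = 2 := by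
  have : ⟪a, a⟫ ≠ 0 := inner_self_ne_zero.mpr ha
  rw [cartan]
  field_simp

lemma inner_sub_cartan_smul (x y b : E) (hb : b ≠ 0) :
    ⟪x - cartan x b • b, y - cartan y b • b⟫ = ⟪x, y⟫ := by
  have : ⟪b, b⟫ ≠ 0 := inner_self_ne_zero.mpr hb
  simp only [cartan, inner_sub_left, inner_sub_right, real_inner_smul_left, real_inner_smul_right,
    real_inner_comm b]
  field_simp
  ring

lemma mem_roots_and_inner_eq_of_mem_weylGroup (R : RootSystemWithBase E) {w : E ≃ₗ[ℝ] E}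
    (hw : w ∈ WeylGroup R) :
    (∀ a ∈ R.roots, w a ∈ R.roots) ∧ ∀ x y, ⟪w x, w y⟫ = ⟪x, y⟫ := by
  have key : ∀ g : E ≃ₗ[ℝ] E, (∃ b ∈ R.roots, ∀ x, g x = x - cartan x b • b) →
      (∀ a ∈ R.roots, g a ∈ R.roots) ∧ ∀ x y, ⟪g x, g y⟫ = ⟪x, y⟫ := by
    rintro g ⟨b, hb, hg⟩
    refine ⟨fun a ha => hg a ▸ R.reflect_mem a ha b hb, fun x y => ?_⟩
    rw [hg, hg, inner_sub_cartan_smul _ _ _ (R.ne_zero b hb)]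
  induction hw using Subgroup.closure_induction with
  | mem g hg => exact key g hg
  | one => exact ⟨fun a ha => ha, fun _ _ => rfl⟩
  | mul g h _ _ hg hh =>
    exact ⟨fun a ha => hg.1 _ (hh.1 a ha), fun x y => (hg.2 _ _).trans (hh.2 x y)⟩
  | inv g _ hg =>
    refine ⟨fun a ha => ?_, fun x y => ?_⟩
    · have hmaps : Set.MapsTo g R.roots R.roots := hg.1
      obtain ⟨b, hb, rfl⟩ := (R.finite.injOn_iff_bijOn_of_mapsTo hmaps).mp
        g.injective.injOn |>.surjOn ha
      simpa using hb
    · rw [← hg.2]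
      congr 1 <;> exact g.apply_symm_apply _

section simpleReflection

variable (R : RootSystemWithBase E) {α : E} {s : E ≃ₗ[ℝ] E}

lemma reflection_self (hα : α ≠ 0) (hs : ∀ x, s x = x - cartan x α • α) : s α = -α := by
  rw [hs, cartan_self_s9 hα, two_smul]
  abel

lemma reflection_reflection (hα : α ≠ 0) (hs : ∀ x, s x = x - cartan x α • α) (x : E) :
    s (s x) = x := by
  rw [hs x, map_sub, map_smul, reflection_self hα hs, hs x]
  simp

lemma reflection_mem_pos (hα : α ∈ R.simples) (hs : ∀ x, s x = x - cartan x α • α) {a : E}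
    (ha : a ∈ R.pos) (hne : a ≠ α) : s a ∈ R.pos := by
  have hroot := R.reflect_mem a ha.1 α (R.simples_sub hα)
  rw [hs]
  rw [sub_eq_add_neg, ← neg_smul] at hroot ⊢
  exact R.add_smul_simple_mem_pos hα ha hne hroot

lemma finite_inversions (w : E ≃ₗ[ℝ] E) : {a : E | a ∈ R.pos ∧ -(w a) ∈ R.pos}.Finite :=
  R.finite.subset fun _ ha => ha.1.1

lemma lenN_mul_reflection (hα : α ∈ R.simples) (hs : ∀ x, s x = x - cartan x α • α)
    (w : E ≃ₗ[ℝ] E) (hw : -(w α) ∈ R.pos) : lenN R (w * s) + 1 = lenN R w := by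
  have hα₀ := R.ne_zero α (R.simples_sub hα)
  have himage : {a : E | a ∈ R.pos ∧ -((w * s) a) ∈ R.pos} =
      s '' ({a : E | a ∈ R.pos ∧ -(w a) ∈ R.pos} \ {α}) := by
    ext a
    constructor
    · rintro ⟨ha, hwa⟩
      have hne : a ≠ α := by
        rintro rfl
        refine R.neg_notMem_pos_s9 hw ?_
        simpa [reflection_self hα₀ hs] using hwa
      refine ⟨s a, ⟨⟨reflection_mem_pos R hα hs ha hne, hwa⟩, fun h => ?_⟩,
        reflection_reflection hα₀ hs a⟩
      refine R.neg_notMem_pos_s9 (R.simple_mem_pos hα) ?_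
      rw [← reflection_self hα₀ hs, ← Set.mem_singleton_iff.mp h, reflection_reflection hα₀ hs]
      exact ha
    · rintro ⟨b, ⟨⟨hb, hwb⟩, hne⟩, rfl⟩
      refine ⟨reflection_mem_pos R hα hs hb hne, ?_⟩
      rwa [LinearEquiv.mul_apply, reflection_reflection hα₀ hs]
  rw [lenN, himage, Set.ncard_image_of_injective _ s.injective]
  exact Set.ncard_sdiff_singleton_add_one ⟨R.simple_mem_pos hα, hw⟩ (finite_inversions R w)

lemma lenN_eq_of_mul_eq_one {w v : E ≃ₗ[ℝ] E} (h : v * w = 1) : lenN R v = lenN R w := by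
  have hvw (x : E) : v (w x) = x := LinearEquiv.congr_fun h x
  have hwv (x : E) : w (v x) = x := LinearEquiv.congr_fun (mul_eq_one_comm.mp h) x
  have himage : {a : E | a ∈ R.pos ∧ -(v a) ∈ R.pos} =
      (fun a => -(w a)) '' {a : E | a ∈ R.pos ∧ -(w a) ∈ R.pos} := by
    ext a
    constructor
    · rintro ⟨ha, hva⟩
      exact ⟨-(v a), ⟨hva, by simpa [hwv] using ha⟩, by simp [hwv]⟩
    · rintro ⟨b, ⟨hb, hwb⟩, rfl⟩
      exact ⟨hwb, by simpa [hvw] using hb⟩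
  rw [lenN, himage]
  exact Set.ncard_image_of_injective _ (neg_injective.comp w.injective)

end simpleReflection

lemma rkDiff_conj (w g : E ≃ₗ[ℝ] E) : rkDiff (g * w * g⁻¹) = rkDiff w := by
  have h : (g * w * g⁻¹).toLinearMap - (LinearMap.id : E →ₗ[ℝ] E) =
      g.toLinearMap ∘ₗ (w.toLinearMap - LinearMap.id) ∘ₗ (g⁻¹ : E ≃ₗ[ℝ] E).toLinearMap := by
    ext x
    simp
  rw [rkDiff, h, LinearMap.range_comp, LinearEquiv.finrank_map_eq, LinearEquiv.range_comp, rkDiff]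

lemma mem_range_sub_id_iff {w : E ≃ₗ[ℝ] E} (hw : w * w = 1) (x : E) :
    x ∈ LinearMap.range (w.toLinearMap - (LinearMap.id : E →ₗ[ℝ] E)) ↔ w x = -x := by
  have hww (x : E) : w (w x) = x := LinearEquiv.congr_fun hw x
  constructor
  · rintro ⟨y, rfl⟩
    simp [hww]
  · intro h
    refine ⟨-(1 / 2 : ℝ) • x, ?_⟩
    simp only [LinearMap.sub_apply, LinearEquiv.coe_coe, LinearMap.id_apply, map_smul, h]
    module

/-- A linear isometry sending `α` to `-α` commutes with the reflection in `α`. -/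
lemma reflection_mul_comm {α : E} {s σ : E ≃ₗ[ℝ] E} (hs : ∀ x, s x = x - cartan x α • α)
    (hinner : ∀ x y, ⟪σ x, σ y⟫ = ⟪x, y⟫) (hσα : σ α = -α) : s * σ = σ * s := by
  ext x
  have h : ⟪σ x, α⟫ = -⟪x, α⟫ := by
    rw [← hinner x α, hσα, inner_neg_right, neg_neg]
  have hc : cartan (σ x) α = -cartan x α := by
    rw [cartan, h, cartan, mul_neg, neg_div]
  rw [LinearEquiv.mul_apply, LinearEquiv.mul_apply, hs, hs, hc, map_sub, map_smul, hσα]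
  simp

lemma map_eq_neg_of_reflection_mul_comm (R : RootSystemWithBase E) {α : E} (hα : α ∈ R.simples)
    {s σ : E ≃ₗ[ℝ] E} (hs : ∀ x, s x = x - cartan x α • α) (hneg : -(σ α) ∈ R.pos)
    (hcomm : s * σ = σ * s) : σ α = -α := by
  have h := LinearEquiv.congr_fun hcomm α
  rw [LinearEquiv.mul_apply, LinearEquiv.mul_apply,
    reflection_self (R.ne_zero α (R.simples_sub hα)) hs, map_neg, hs] at h
  by_contra hne
  have hp := reflection_mem_pos R hα hs hneg fun h' => hne (neg_eq_iff_eq_neg.mp h')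
  rw [map_neg, hs, h, neg_neg] at hp
  exact R.neg_notMem_pos_s9 hp hneg

end inversions

lemma rkDiff_reflection_mul {α : V} (hα : α ≠ 0) {s σ : V ≃ₗ[ℝ] V}
    (hs : ∀ x, s x = x - cartan x α • α) (hσ : σ * σ = 1)
    (hinner : ∀ x y, ⟪σ x, σ y⟫ = ⟪x, y⟫) (hσα : σ α = -α) (hcomm : s * σ = σ * s) :
    rkDiff (s * σ) + 1 = rkDiff σ := by
  have hss : s * s = 1 := LinearEquiv.ext (reflection_reflection hα hs)
  have hinv : s * σ * (s * σ) = 1 := by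
    rw [mul_assoc, ← mul_assoc σ, ← hcomm, mul_assoc s σ σ, hσ, mul_one, hss]
  have hle : Submodule.span ℝ {α} ≤
      LinearMap.range (σ.toLinearMap - (LinearMap.id : V →ₗ[ℝ] V)) := by
    rw [Submodule.span_singleton_le_iff_mem, mem_range_sub_id_iff hσ, hσα]
  have hrange : LinearMap.range ((s * σ).toLinearMap - (LinearMap.id : V →ₗ[ℝ] V)) =
      (Submodule.span ℝ {α})ᗮ ⊓ LinearMap.range (σ.toLinearMap - (LinearMap.id : V →ₗ[ℝ] V)) := by
    ext x
    rw [Submodule.mem_inf, mem_range_sub_id_iff hinv, mem_range_sub_id_iff hσ,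
      Submodule.mem_orthogonal_singleton_iff_inner_left, LinearEquiv.mul_apply]
    constructor
    · intro h
      have hσx : σ x = -x + cartan x α • α := by
        rw [← reflection_reflection hα hs (σ x), h, map_neg, hs]
        abel
      have h₁ : ⟪σ x, α⟫ = -⟪x, α⟫ := by
        rw [← hinner x α, hσα, inner_neg_right, neg_neg]
      have hc : cartan x α = 0 := by
        rw [hσx, inner_add_left, inner_neg_left, real_inner_smul_left] at h₁
        have : cartan x α * ⟪α, α⟫ = 0 := by linarith
        exact (mul_eq_zero.mp this).resolve_right (inner_self_ne_zero.mpr hα)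
      refine ⟨?_, by simpa [hc] using hσx⟩
      have h2 : 2 * ⟪x, α⟫ = 0 :=
        (div_eq_zero_iff.mp hc).resolve_right (inner_self_ne_zero.mpr hα)
      linarith
    · rintro ⟨h, hσx⟩
      rw [hσx, map_neg, hs, cartan, h]
      simp
  rw [rkDiff, hrange, rkDiff, ← Submodule.finrank_add_inf_finrank_orthogonal hle,
    finrank_span_singleton hα, add_comm]

/-- Let `σ` be an involution in the Weyl group and `α ∈ Δ` a simple root with
`σ(α) ∈ Φ⁻`; let `s∘σ = s_α σ` if `s_α σ = σ s_α` and `s∘σ = s_α σ s_α` otherwise.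
Then `N(s∘σ) + r(s∘σ) = N(σ) + r(σ) - 2`. -/
theorem stmt_9 (R : RootSystemWithBase V) (σ : V ≃ₗ[ℝ] V) (hσW : σ ∈ WeylGroup R)
    (hinv : σ * σ = 1) (α : V) (hα : α ∈ R.simples) (hneg : -(σ α) ∈ R.pos)
    (sα : V ≃ₗ[ℝ] V) (hsα : ∀ x, sα x = x - cartan x α • α) :
    (sα * σ = σ * sα →
      lenN R (sα * σ) + rkDiff (sα * σ) + 2 = lenN R σ + rkDiff σ) ∧
    (sα * σ ≠ σ * sα →
      lenN R (sα * σ * sα) + rkDiff (sα * σ * sα) + 2 = lenN R σ + rkDiff σ) := by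
  have hα₀ : α ≠ 0 := R.ne_zero α (R.simples_sub hα)
  obtain ⟨-, hinner⟩ := mem_roots_and_inner_eq_of_mem_weylGroup R hσW
  have hss : sα * sα = 1 := LinearEquiv.ext (reflection_reflection hα₀ hsα)
  have hN : lenN R (σ * sα) + 1 = lenN R σ := lenN_mul_reflection R hα hsα σ hneg
  refine ⟨fun hcomm => ?_, fun hcomm => ?_⟩
  · have hr := rkDiff_reflection_mul hα₀ hsα hinv hinner
      (map_eq_neg_of_reflection_mul_comm R hα hsα hneg hcomm) hcomm
    rw [← hcomm] at hN
    omega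
  · have hne : -(σ α) ≠ α := fun h =>
      hcomm (reflection_mul_comm hsα hinner (neg_eq_iff_eq_neg.mp h))
    have hNinv : lenN R (sα * σ) = lenN R (σ * sα) :=
      lenN_eq_of_mul_eq_one R (by rw [mul_assoc, ← mul_assoc σ, hinv, one_mul, hss])
    have hNs : lenN R (sα * σ * sα) + 1 = lenN R (sα * σ) :=
      lenN_mul_reflection R hα hsα _ (by
        simpa using reflection_mem_pos R hα hsα hneg hne)
    have hr : rkDiff (sα * σ * sα) = rkDiff σ := by
      have h := rkDiff_conj σ sα
      rwa [inv_eq_of_mul_eq_one_right hss] at h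
    omega
end

section
/- Let (W, S) be a Coxeter system with Bruhat order ≤, let s ∈ S, and let σ, τ ∈ W be involutions with σ < τ. (i) If s∘σ > σ and s∘τ > τ, then s∘σ < s∘τ. (ii) If s∘σ < σ and s∘τ < τ, then s∘σ < s∘τ. -/
variable {B W : Type*} [Group W] {M : CoxeterMatrix B}

/-- The Bruhat strict order on a Coxeter group: the partial order generated by the
relations `u < t * u` whenever `t` is a reflection and `ℓ(u) < ℓ(t * u)`. -/
def bruhatLT (cs : CoxeterSystem M W) : W → W → Prop :=
  Relation.TransGen fun u v =>
    (∃ t, cs.IsReflection t ∧ v = t * u) ∧ cs.length u < cs.length v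

/-- The Bruhat order on a Coxeter group (the reflexive closure of `bruhatLT`). -/
def bruhatLE (cs : CoxeterSystem M W) : W → W → Prop :=
  Relation.ReflTransGen fun u v =>
    (∃ t, cs.IsReflection t ∧ v = t * u) ∧ cs.length u < cs.length v

open Classical in
/-- For an involution `σ` and a simple reflection `s = sᵢ`, the involution
`s∘σ`, defined as `sσ` if `sσ = σs` and as `sσs` otherwise. -/
noncomputable def conjOp (cs : CoxeterSystem M W) (i : B) (σ : W) : W :=
  if cs.simple i * σ = σ * cs.simple i then cs.simple i * σ
  else cs.simple i * σ * cs.simple i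

section ReflectionParity

variable (cs : CoxeterSystem M W)

open Classical in
/-- The action of the simple reflection `sᵢ` on pairs `(x, ε)` consisting of an element of `W`
and a sign: `x` is conjugated by `sᵢ`, and the sign changes exactly when `x = sᵢ`. -/
noncomputable def simpleSignedPerm (i : B) : Equiv.Perm (W × ZMod 2) :=
  Function.Involutive.toPerm
    (fun p => (cs.simple i * p.1 * cs.simple i, p.2 + if p.1 = cs.simple i then 1 else 0)) <| by
    rintro ⟨x, ε⟩
    have h : cs.simple i * x * cs.simple i = cs.simple i ↔ x = cs.simple i := by
      rw [mul_eq_right, mul_eq_one_iff_eq_inv', cs.inv_simple]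
    ext
    · simp [mul_assoc]
    · simp only [h, add_assoc, CharTwo.add_self_eq_zero, add_zero]

open Classical in
theorem simpleSignedPerm_apply (i : B) (x : W) (ε : ZMod 2) :
    simpleSignedPerm cs i (x, ε) =
      (cs.simple i * x * cs.simple i, ε + if x = cs.simple i then 1 else 0) := rfl

open Classical in
theorem simpleSignedPerm_mul_pow_apply (i j : B) (n : ℕ) (x : W) (ε : ZMod 2) :
    ((simpleSignedPerm cs i * simpleSignedPerm cs j) ^ n) (x, ε) =
      ((cs.simple i * cs.simple j) ^ n * x * ((cs.simple i * cs.simple j) ^ n)⁻¹,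
        ε + ∑ l ∈ Finset.range (2 * n),
          if x = cs.simple j * (cs.simple i * cs.simple j) ^ l then 1 else 0) := by
  induction n with
  | zero => simp
  | succ n ih =>
    set r := cs.simple i * cs.simple j with hr
    have hrinv : r⁻¹ = cs.simple j * cs.simple i := by simp [hr]
    have hcomm : ∀ n : ℕ, (r ^ n)⁻¹ * cs.simple j = cs.simple j * r ^ n := by
      intro n
      induction n with
      | zero => simp
      | succ n ihn =>
        rw [pow_succ, mul_inv_rev, mul_assoc, ihn, ← mul_assoc, hrinv,
          mul_assoc (cs.simple j) (cs.simple i), ← hr, mul_assoc, ← pow_succ', pow_succ]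
    have h₁ : r ^ n * x * (r ^ n)⁻¹ = cs.simple j ↔ x = cs.simple j * r ^ (2 * n) := by
      rw [mul_inv_eq_iff_eq_mul, ← eq_inv_mul_iff_mul_eq, ← mul_assoc, hcomm, mul_assoc, ← pow_add,
        two_mul]
    have h₂ : cs.simple j * (r ^ n * x * (r ^ n)⁻¹) * cs.simple j = cs.simple i ↔
        x = cs.simple j * r ^ (2 * n + 1) := by
      have : cs.simple j * (r ^ n * x * (r ^ n)⁻¹) * cs.simple j = cs.simple i ↔
          r ^ n * x * (r ^ n)⁻¹ = cs.simple j * r := by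
        rw [mul_assoc (cs.simple j), ← eq_inv_mul_iff_mul_eq, ← eq_mul_inv_iff_mul_eq]
        simp [hr, mul_assoc]
      rw [this, mul_inv_eq_iff_eq_mul, ← eq_inv_mul_iff_mul_eq, mul_assoc, ← mul_assoc, hcomm,
        mul_assoc, ← pow_succ', ← pow_add]
      congr! 3
      ring
    rw [pow_succ', Equiv.Perm.mul_apply, ih, Equiv.Perm.mul_apply, simpleSignedPerm_apply,
      simpleSignedPerm_apply, h₁, h₂, mul_add, mul_one, Finset.sum_range_succ,
      Finset.sum_range_succ]
    ext
    · simp [pow_succ', hr, mul_assoc]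
    · simp only [add_assoc]

theorem isLiftable_simpleSignedPerm : M.IsLiftable (simpleSignedPerm cs) := by
  intro i j
  ext1 ⟨x, ε⟩
  rw [simpleSignedPerm_mul_pow_apply, two_mul, Finset.sum_range_add]
  have h (l : ℕ) : (cs.simple i * cs.simple j) ^ (M i j + l) =
      (cs.simple i * cs.simple j) ^ l := by
    rw [pow_add, cs.simple_mul_simple_pow, one_mul]
  have hsum (f : W → ZMod 2) :
      ∑ l ∈ Finset.range (M i j), f ((cs.simple i * cs.simple j) ^ (M i j + l)) =
        ∑ l ∈ Finset.range (M i j), f ((cs.simple i * cs.simple j) ^ l) := by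
    simp only [h]
  classical
  rw [hsum (fun y => if x = cs.simple j * y then 1 else 0), CharTwo.add_self_eq_zero]
  simp

/-- The action of `W` on signed elements of `W` extending `simpleSignedPerm`. -/
noncomputable def signedPerm : W →* Equiv.Perm (W × ZMod 2) :=
  cs.lift ⟨simpleSignedPerm cs, isLiftable_simpleSignedPerm cs⟩

/-- The parity of the number of occurrences of `x` in the right inversion sequence of any word
for `w`. -/
noncomputable def inversionParity (w x : W) : ZMod 2 := (signedPerm cs w (x, 0)).2

theorem signedPerm_simple (i : B) : signedPerm cs (cs.simple i) = simpleSignedPerm cs i :=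
  cs.lift_apply_simple _ i

theorem signedPerm_apply (w x : W) (ε : ZMod 2) :
    signedPerm cs w (x, ε) = (w * x * w⁻¹, ε + inversionParity cs w x) := by
  have h : ∃ c, ∀ ε, signedPerm cs w (x, ε) = (w * x * w⁻¹, ε + c) := by
    induction w using cs.simple_induction_left with
    | one => exact ⟨0, by simp⟩
    | mul_simple_left w i ih =>
      obtain ⟨c, hc⟩ := ih
      simp only [map_mul, Equiv.Perm.mul_apply, signedPerm_simple, hc, simpleSignedPerm_apply,
        add_assoc, mul_inv_rev, cs.inv_simple, mul_assoc]
      exact ⟨_, fun _ => rfl⟩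
  obtain ⟨c, hc⟩ := h
  rw [inversionParity, hc, hc, zero_add]

theorem inversionParity_mul (u w x : W) :
    inversionParity cs (u * w) x = inversionParity cs w x + inversionParity cs u (w * x * w⁻¹) := by
  rw [inversionParity, map_mul, Equiv.Perm.mul_apply, signedPerm_apply, signedPerm_apply, zero_add]

open Classical in
theorem inversionParity_simple (i : B) (x : W) :
    inversionParity cs (cs.simple i) x = if x = cs.simple i then 1 else 0 := by
  rw [inversionParity, signedPerm_simple, simpleSignedPerm_apply, zero_add]

theorem inversionParity_one (x : W) : inversionParity cs 1 x = 0 := by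
  simp [inversionParity]

theorem inversionParity_wordProd_eq_zero {ω : List B} {x : W} (hx : x ∉ cs.rightInvSeq ω) :
    inversionParity cs (cs.wordProd ω) x = 0 := by
  induction ω with
  | nil => simp [inversionParity_one]
  | cons i ω ih =>
    simp only [CoxeterSystem.rightInvSeq, List.mem_cons, not_or] at hx
    rw [cs.wordProd_cons, inversionParity_mul, ih hx.2, inversionParity_simple, if_neg, add_zero]
    intro h
    apply hx.1
    rw [← h]
    group

theorem inversionParity_self {t : W} (ht : cs.IsReflection t) : inversionParity cs t t = 1 := by
  obtain ⟨w, i, rfl⟩ := ht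
  have h : inversionParity cs w⁻¹ (w * cs.simple i * w⁻¹) +
      inversionParity cs w (cs.simple i) = 0 := by
    have := inversionParity_mul cs w w⁻¹ (w * cs.simple i * w⁻¹)
    rw [mul_inv_cancel, inversionParity_one] at this
    simpa [mul_assoc] using this.symm
  rw [inversionParity_mul, inversionParity_mul, inversionParity_simple]
  have h₁ : w⁻¹ * (w * cs.simple i * w⁻¹) * w⁻¹⁻¹ = cs.simple i := by group
  rw [h₁, if_pos rfl, mul_inv_cancel_right, add_left_comm, h, add_zero]

theorem length_mul_lt_iff_inversionParity_eq_one (w : W) {t : W} (ht : cs.IsReflection t) :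
    cs.length (w * t) < cs.length w ↔ inversionParity cs w t = 1 := by
  have key : ∀ v : W, inversionParity cs v t ≠ 0 → cs.length (v * t) < cs.length v := by
    intro v hv
    obtain ⟨ω, hω, rfl⟩ := cs.exists_isReduced v
    by_contra h
    exact hv (inversionParity_wordProd_eq_zero cs fun hmem =>
      h (cs.isRightInversion_of_mem_rightInvSeq hω hmem).2)
  refine ⟨fun h => ?_, fun h => key w (by simp [h])⟩
  by_contra hne
  have h₀ : inversionParity cs w t = 0 := by
    generalize inversionParity cs w t = a at hne
    revert a
    decide
  have := key (w * t) (by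
    rw [inversionParity_mul, inversionParity_self cs ht, ht.mul_self, one_mul, ht.inv, h₀]
    decide)
  rw [mul_assoc, ht.mul_self, mul_one] at this
  omega

/-- Left multiplication by a simple reflection `s` preserves `w < t * w`, unless `t = s`. -/
theorem length_simple_mul_lt_length_simple_mul {w t : W} (ht : cs.IsReflection t) (i : B)
    (hne : t ≠ cs.simple i) (h : cs.length w < cs.length (t * w)) :
    cs.length (cs.simple i * w) < cs.length (cs.simple i * (t * w)) := by
  have ht' : cs.IsReflection (cs.simple i * t * cs.simple i) := by
    simpa using ht.conj (cs.simple i)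
  have hpar (u t : W) (ht : cs.IsReflection t) :
      cs.length u < cs.length (t * u) ↔ inversionParity cs u⁻¹ t ≠ 1 := by
    rw [ne_eq, ← length_mul_lt_iff_inversionParity_eq_one cs u⁻¹ ht, ← cs.length_inv (t * u),
      ← cs.length_inv u, mul_inv_rev, ht.inv]
    have := ht.length_mul_left_ne u⁻¹
    omega
  have hmul : cs.simple i * (t * w) = cs.simple i * t * cs.simple i * (cs.simple i * w) := by
    simp [mul_assoc]
  rw [hmul, hpar _ _ ht', mul_inv_rev, inversionParity_mul, cs.inv_simple, inversionParity_simple,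
    if_neg]
  · simpa [mul_assoc] using (hpar w t ht).1 h
  · intro heq
    apply hne
    rwa [mul_eq_right, mul_eq_one_iff_eq_inv', cs.inv_simple] at heq

end ReflectionParity

section BruhatOrder

variable {cs : CoxeterSystem M W}

theorem bruhatLE.trans {u v w : W} (h₁ : bruhatLE cs u v) (h₂ : bruhatLE cs v w) :
    bruhatLE cs u w :=
  Relation.ReflTransGen.trans h₁ h₂

theorem bruhatLT.le {u v : W} (h : bruhatLT cs u v) : bruhatLE cs u v :=
  Relation.TransGen.to_reflTransGen h

theorem bruhatLT.length_lt {u v : W} (h : bruhatLT cs u v) : cs.length u < cs.length v := by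
  induction h with
  | single h => exact h.2
  | tail _ h ih => exact ih.trans h.2

theorem bruhatLE.lt_of_ne {u v : W} (h : bruhatLE cs u v) (hne : u ≠ v) : bruhatLT cs u v :=
  (Relation.reflTransGen_iff_eq_or_transGen.1 h).resolve_left hne.symm

theorem bruhatLE_of_reflection {u v t : W} (ht : cs.IsReflection t) (h : v = t * u)
    (hlt : cs.length u < cs.length v) : bruhatLE cs u v :=
  Relation.ReflTransGen.single ⟨⟨t, ht, h⟩, hlt⟩

theorem bruhatLE_simple_mul {u : W} {i : B} (h : cs.length u < cs.length (cs.simple i * u)) :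
    bruhatLE cs u (cs.simple i * u) :=
  bruhatLE_of_reflection (cs.isReflection_simple i) rfl h

theorem simple_mul_bruhatLE {u : W} {i : B} (h : cs.length (cs.simple i * u) < cs.length u) :
    bruhatLE cs (cs.simple i * u) u :=
  bruhatLE_of_reflection (cs.isReflection_simple i) (by simp) h

theorem bruhatLE.inv {u v : W} (h : bruhatLE cs u v) : bruhatLE cs u⁻¹ v⁻¹ := by
  induction h with
  | refl => exact Relation.ReflTransGen.refl
  | @tail v w _ hs ih =>
    obtain ⟨⟨t, ht, rfl⟩, hlt⟩ := hs
    refine ih.trans (bruhatLE_of_reflection (by simpa using ht.conj v⁻¹) ?_ ?_)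
    · simp [ht.inv, mul_assoc]
    · simpa only [cs.length_inv] using hlt

theorem bruhatLE.simple_mul_le_or {u v : W} (h : bruhatLE cs u v) (i : B) :
    bruhatLE cs (cs.simple i * u) v ∨ bruhatLE cs (cs.simple i * u) (cs.simple i * v) := by
  induction h with
  | refl => exact Or.inr Relation.ReflTransGen.refl
  | @tail v w _ hs ih =>
    have hvw : bruhatLE cs v w := Relation.ReflTransGen.single hs
    obtain ⟨⟨t, ht, rfl⟩, hlt⟩ := hs
    rcases ih with ih | ih
    · exact Or.inl (ih.trans hvw)
    · by_cases hts : t = cs.simple i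
      · subst hts
        exact Or.inl ih
      · refine Or.inr (ih.trans (bruhatLE_of_reflection (t := cs.simple i * t * cs.simple i)
          (by simpa using ht.conj (cs.simple i)) (by simp [mul_assoc])
          (length_simple_mul_lt_length_simple_mul cs ht i hts hlt)))

theorem bruhatLE.le_simple_mul_or {u v : W} (h : bruhatLE cs u v) (i : B) :
    bruhatLE cs u (cs.simple i * v) ∨ bruhatLE cs (cs.simple i * u) (cs.simple i * v) := by
  induction h with
  | refl => exact Or.inr Relation.ReflTransGen.refl
  | @tail v w huv hs ih =>
    obtain ⟨⟨t, ht, rfl⟩, hlt⟩ := hs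
    by_cases hts : t = cs.simple i
    · subst hts
      rw [cs.simple_mul_simple_cancel_left]
      exact Or.inl huv
    · have hstep : bruhatLE cs (cs.simple i * v) (cs.simple i * (t * v)) :=
        bruhatLE_of_reflection (t := cs.simple i * t * cs.simple i)
          (by simpa using ht.conj (cs.simple i)) (by simp [mul_assoc])
          (length_simple_mul_lt_length_simple_mul cs ht i hts hlt)
      exact ih.imp (·.trans hstep) (·.trans hstep)

theorem bruhatLE.simple_mul_of_not_isLeftDescent {u v : W} {i : B} (h : bruhatLE cs u v)
    (hv : cs.length v < cs.length (cs.simple i * v)) :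
    bruhatLE cs (cs.simple i * u) (cs.simple i * v) :=
  (h.simple_mul_le_or i).elim (·.trans (bruhatLE_simple_mul hv)) id

theorem bruhatLE.simple_mul_of_isLeftDescent {u v : W} {i : B} (h : bruhatLE cs u v)
    (hu : cs.length (cs.simple i * u) < cs.length u) :
    bruhatLE cs (cs.simple i * u) (cs.simple i * v) :=
  (h.le_simple_mul_or i).elim (simple_mul_bruhatLE hu).trans id

theorem length_simple_mul_inv (w : W) (i : B) :
    cs.length (cs.simple i * w⁻¹) = cs.length (w * cs.simple i) := by
  rw [← cs.length_inv (w * cs.simple i), mul_inv_rev, cs.inv_simple]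

theorem bruhatLE_mul_simple {u : W} {i : B} (h : cs.length u < cs.length (u * cs.simple i)) :
    bruhatLE cs u (u * cs.simple i) := by
  simpa using (bruhatLE_simple_mul (cs := cs) (u := u⁻¹) (i := i)
    (by rwa [length_simple_mul_inv, cs.length_inv])).inv

theorem mul_simple_bruhatLE {u : W} {i : B} (h : cs.length (u * cs.simple i) < cs.length u) :
    bruhatLE cs (u * cs.simple i) u := by
  simpa using (simple_mul_bruhatLE (cs := cs) (u := u⁻¹) (i := i)
    (by rwa [length_simple_mul_inv, cs.length_inv])).inv

theorem bruhatLE.mul_simple_le_or {u v : W} (h : bruhatLE cs u v) (i : B) :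
    bruhatLE cs (u * cs.simple i) v ∨ bruhatLE cs (u * cs.simple i) (v * cs.simple i) :=
  (h.inv.simple_mul_le_or i).imp (fun h => by simpa using h.inv) (fun h => by simpa using h.inv)

theorem bruhatLE.le_mul_simple_or {u v : W} (h : bruhatLE cs u v) (i : B) :
    bruhatLE cs u (v * cs.simple i) ∨ bruhatLE cs (u * cs.simple i) (v * cs.simple i) :=
  (h.inv.le_simple_mul_or i).imp (fun h => by simpa using h.inv) (fun h => by simpa using h.inv)

end BruhatOrder

section ConjOp

variable {cs : CoxeterSystem M W}

theorem conjOp_conjOp (i : B) (σ : W) : conjOp cs i (conjOp cs i σ) = σ := by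
  by_cases h : cs.simple i * σ = σ * cs.simple i
  · have h' : cs.simple i * (cs.simple i * σ) = cs.simple i * σ * cs.simple i := by
      rw [mul_assoc, h]
    rw [conjOp, conjOp, if_pos h, if_pos h', cs.simple_mul_simple_cancel_left]
  · have h' : ¬ cs.simple i * (cs.simple i * σ * cs.simple i) =
        cs.simple i * σ * cs.simple i * cs.simple i := by
      simpa [mul_assoc] using fun h' => h h'.symm
    rw [conjOp, conjOp, if_neg h, if_neg h']
    simp [mul_assoc]

/-- If `s∘σ > σ`, then each multiplication by `s` used in forming `s∘σ` increases the length. -/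
theorem length_lt_of_bruhatLT_conjOp {σ : W} {i : B} (h : bruhatLT cs σ (conjOp cs i σ)) :
    cs.length σ < cs.length (cs.simple i * σ) ∧
      (cs.simple i * σ ≠ σ * cs.simple i →
        cs.length (cs.simple i * σ) < cs.length (cs.simple i * σ * cs.simple i)) := by
  have hlt := h.length_lt
  unfold conjOp at hlt
  split_ifs at hlt with hc
  · exact ⟨hlt, fun hne => absurd hc hne⟩
  · have := cs.length_simple_mul σ i
    have := cs.length_mul_simple (cs.simple i * σ) i
    omega

/-- If `s∘σ < σ`, then each multiplication by `s` used in forming `s∘σ` decreases the length. -/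
theorem length_lt_of_conjOp_bruhatLT {σ : W} {i : B} (h : bruhatLT cs (conjOp cs i σ) σ) :
    cs.length (cs.simple i * σ) < cs.length σ ∧
      (cs.simple i * σ ≠ σ * cs.simple i →
        cs.length (cs.simple i * σ * cs.simple i) < cs.length (cs.simple i * σ)) := by
  have hlt := h.length_lt
  unfold conjOp at hlt
  split_ifs at hlt with hc
  · exact ⟨hlt, fun hne => absurd hc hne⟩
  · have := cs.length_simple_mul σ i
    have := cs.length_mul_simple (cs.simple i * σ) i
    omega

end ConjOp

/-- Let `σ < τ` be involutions in a Coxeter group and `s` a simple reflection.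
(i) If `s∘σ > σ` and `s∘τ > τ`, then `s∘σ < s∘τ`.
(ii) If `s∘σ < σ` and `s∘τ < τ`, then `s∘σ < s∘τ`. -/
theorem stmt_11 (cs : CoxeterSystem M W) (σ τ : W)
    (hσ : σ * σ = 1) (hτ : τ * τ = 1) (hστ : bruhatLT cs σ τ) (i : B) :
    (bruhatLT cs σ (conjOp cs i σ) → bruhatLT cs τ (conjOp cs i τ) →
      bruhatLT cs (conjOp cs i σ) (conjOp cs i τ)) ∧
    (bruhatLT cs (conjOp cs i σ) σ → bruhatLT cs (conjOp cs i τ) τ →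
      bruhatLT cs (conjOp cs i σ) (conjOp cs i τ)) := by
  have hne : conjOp cs i σ ≠ conjOp cs i τ := fun h =>
    hστ.length_lt.ne (by rw [← conjOp_conjOp (cs := cs) i σ, h, conjOp_conjOp])
  refine ⟨fun h₁ h₂ => bruhatLE.lt_of_ne ?_ hne, fun h₁ h₂ => bruhatLE.lt_of_ne ?_ hne⟩
  · obtain ⟨hτ₁, hτ₂⟩ := length_lt_of_bruhatLT_conjOp h₂
    have hle := hστ.le.simple_mul_of_not_isLeftDescent hτ₁
    unfold conjOp
    split_ifs with hcσ hcτ hcτ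
    · exact hle
    · exact hle.trans (bruhatLE_mul_simple (hτ₂ hcτ))
    · refine (hle.mul_simple_le_or i).elim id fun h => h.trans ?_
      rw [hcτ, mul_assoc, cs.simple_mul_simple_self, mul_one, ← hcτ]
      exact bruhatLE_simple_mul hτ₁
    · exact (hle.mul_simple_le_or i).elim (·.trans (bruhatLE_mul_simple (hτ₂ hcτ))) id
  · obtain ⟨hσ₁, hσ₂⟩ := length_lt_of_conjOp_bruhatLT h₁
    have hle := hστ.le.simple_mul_of_isLeftDescent hσ₁
    unfold conjOp
    split_ifs with hcσ hcτ hcτ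
    · exact hle
    · refine (hle.le_mul_simple_or i).elim id fun h => bruhatLE.trans ?_ h
      rw [hcσ, mul_assoc, cs.simple_mul_simple_self, mul_one, ← hcσ]
      exact simple_mul_bruhatLE hσ₁
    · exact (mul_simple_bruhatLE (hσ₂ hcσ)).trans hle
    · exact (hle.le_mul_simple_or i).elim (mul_simple_bruhatLE (hσ₂ hcσ)).trans id
end
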